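/- Estimate of the quadratic terms I₃ and I₆: there exists a constant C > 0 depending only on τ₀ such that, under the standing assumptions, ∑_{n≥0} ∑_{|α|=n} |I^α_3| τⁿ Mₙ / ‖θ ⟨r⟩ⁿ ∂^α_h g‖_{L²} + ∑_{n≥0} ∑_{|α|=n} |I^α_6| τⁿ Mₙ / ‖θ ⟨r⟩ⁿ ∂^α_h g‖_{L²} ≤ C τ^{−2} ( ‖g‖_{X_τ} + ‖g‖_{D_τ} ) ‖g‖_{X_τ}. -/

import Mathlib

open MeasureTheory Filter Set

noncomputable section

/-- `⟨t⟩ = 1 + t` -/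
def angT (t : ℝ) : ℝ := 1 + t

/-- `θ_λ(z) = exp (λ z² / (8⟨t⟩))`; `θ = θ₁`. -/
def thw (t lam z : ℝ) : ℝ := Real.exp (lam * z ^ 2 / (8 * angT t))

/-- `⟨r⟩ = √(x² + y² + 1)` -/
def angR (x y : ℝ) : ℝ := Real.sqrt (x ^ 2 + y ^ 2 + 1)

/-- `Mₙ = (n+1)⁴ / n!` -/
def Mfac (n : ℕ) : ℝ := ((n : ℝ) + 1) ^ 4 / (n.factorial : ℝ)

/-- `∂_x` -/
def pdx (f : ℝ → ℝ → ℝ → ℝ) : ℝ → ℝ → ℝ → ℝ := fun x y z => deriv (fun x' => f x' y z) x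
/-- `∂_y` -/
def pdy (f : ℝ → ℝ → ℝ → ℝ) : ℝ → ℝ → ℝ → ℝ := fun x y z => deriv (fun y' => f x y' z) y
/-- `∂_z` -/
def pdz (f : ℝ → ℝ → ℝ → ℝ) : ℝ → ℝ → ℝ → ℝ := fun x y z => deriv (fun z' => f x y z') z

/-- `∂^α_h = ∂_x^{α₁} ∂_y^{α₂}` for the multi-index `α = (a, b)` -/
def pdh (a b : ℕ) (f : ℝ → ℝ → ℝ → ℝ) : ℝ → ℝ → ℝ → ℝ := pdx^[a] (pdy^[b] f)

/-- `r ∂_r = x ∂_x + y ∂_y` -/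
def rdr (f : ℝ → ℝ → ℝ → ℝ) : ℝ → ℝ → ℝ → ℝ := fun x y z => x * pdx f x y z + y * pdy f x y z

/-- weighted `L²` norm over `ℝ² × (0,∞)` of `θ_λ ⟨r⟩ⁿ f` -/
def L2w (t lam : ℝ) (n : ℕ) (f : ℝ → ℝ → ℝ → ℝ) : ℝ :=
  Real.sqrt (∫ x : ℝ, ∫ y : ℝ, ∫ z in Ioi (0 : ℝ), (thw t lam z * angR x y ^ n * f x y z) ^ 2)

/-- weighted `L²_z` norm at fixed `(x, y)` of `θ_λ ⟨r⟩ⁿ f (x, y, ·)` -/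
def L2z (t lam : ℝ) (n : ℕ) (f : ℝ → ℝ → ℝ → ℝ) (x y : ℝ) : ℝ :=
  Real.sqrt (∫ z in Ioi (0 : ℝ), (thw t lam z * angR x y ^ n * f x y z) ^ 2)

/-- mixed `L^∞_h L²_z` norm of `θ_λ ⟨r⟩ⁿ f` -/
def LIh2z (t lam : ℝ) (n : ℕ) (f : ℝ → ℝ → ℝ → ℝ) : ℝ :=
  Real.sqrt (∫ z in Ioi (0 : ℝ), (⨆ p : ℝ × ℝ, |thw t lam z * angR p.1 p.2 ^ n * f p.1 p.2 z|) ^ 2)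

/-- mixed `L²_h L^∞_z` norm of `θ_λ ⟨r⟩ⁿ f` -/
def L2hIz (t lam : ℝ) (n : ℕ) (f : ℝ → ℝ → ℝ → ℝ) : ℝ :=
  Real.sqrt (∫ x : ℝ, ∫ y : ℝ,
    (⨆ z : Ioi (0 : ℝ), |thw t lam (z : ℝ) * angR x y ^ n * f x y (z : ℝ)|) ^ 2)

/-- the primitive `φ(x,y,z) = exp(−z²/(4⟨t⟩)) ∫₀^z g(x,y,s) exp(s²/(4⟨t⟩)) ds` -/
def phiF (t : ℝ) (g : ℝ → ℝ → ℝ → ℝ) : ℝ → ℝ → ℝ → ℝ := fun x y z =>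
  Real.exp (-(z ^ 2) / (4 * angT t)) * ∫ s in (0 : ℝ)..z, g x y s * Real.exp (s ^ 2 / (4 * angT t))

/-- `u^r = ∂_z φ` -/
def ur (t : ℝ) (g : ℝ → ℝ → ℝ → ℝ) : ℝ → ℝ → ℝ → ℝ := pdz (phiF t g)

/-- `u^z = −(x∂_x + y∂_y)φ − 2φ` -/
def uzv (t : ℝ) (g : ℝ → ℝ → ℝ → ℝ) : ℝ → ℝ → ℝ → ℝ := fun x y z =>
  -(rdr (phiF t g) x y z) - 2 * phiF t g x y z

/-- smoothness together with rapid decay in `z` of all derivatives -/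
def DecaySmooth (g : ℝ → ℝ → ℝ → ℝ) : Prop :=
  ContDiff ℝ (⊤ : ℕ∞) (fun p : ℝ × ℝ × ℝ => g p.1 p.2.1 p.2.2) ∧
  ∀ a b k m : ℕ, ∀ x y : ℝ,
    Tendsto (fun z : ℝ => z ^ m * pdz^[k] (pdh a b g) x y z) atTop (nhds 0)

/-- `θ ⟨r⟩^{|α|} ∂^α_h g ∈ L²(ℝ² × (0,∞))` for every `α` -/
def L2cond (t : ℝ) (g : ℝ → ℝ → ℝ → ℝ) : Prop :=
  ∀ a b : ℕ,
    Integrable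
      (fun p : ℝ × ℝ × ℝ =>
        (thw t 1 p.2.2 * angR p.1 p.2.1 ^ (a + b) * pdh a b g p.1 p.2.1 p.2.2) ^ 2)
      (volume.restrict {p : ℝ × ℝ × ℝ | 0 < p.2.2})

/-- `θ ⟨r⟩^{|α|} ∂^α_h ∂_z g ∈ L²(ℝ² × (0,∞))` for every `α` -/
def L2condZ (t : ℝ) (g : ℝ → ℝ → ℝ → ℝ) : Prop :=
  ∀ a b : ℕ,
    Integrable
      (fun p : ℝ × ℝ × ℝ =>
        (thw t 1 p.2.2 * angR p.1 p.2.1 ^ (a + b) * pdh a b (pdz g) p.1 p.2.1 p.2.2) ^ 2)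
      (volume.restrict {p : ℝ × ℝ × ℝ | 0 < p.2.2})

/-- `X_n(g, τ)` -/
def Xel (t τ : ℝ) (g : ℝ → ℝ → ℝ → ℝ) (n : ℕ) : ℝ :=
  (∑ a ∈ Finset.range (n + 1), L2w t 1 n (pdh a (n - a) g)) * τ ^ n * Mfac n

/-- `D_n(g, τ) = X_n(∂_z g, τ)` -/
def Del (t τ : ℝ) (g : ℝ → ℝ → ℝ → ℝ) (n : ℕ) : ℝ :=
  (∑ a ∈ Finset.range (n + 1), L2w t 1 n (pdh a (n - a) (pdz g))) * τ ^ n * Mfac n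

/-- `Y_n(g, τ)` (with `Y₀ = 0`) -/
def Yel (t τ : ℝ) (g : ℝ → ℝ → ℝ → ℝ) (n : ℕ) : ℝ :=
  (∑ a ∈ Finset.range (n + 1), L2w t 1 n (pdh a (n - a) g)) * τ ^ (n - 1) * (n : ℝ) * Mfac n

/-- `‖g‖_{X_τ}` -/
def Xnrm (t τ : ℝ) (g : ℝ → ℝ → ℝ → ℝ) : ℝ := ∑' n : ℕ, Xel t τ g n
/-- `‖g‖_{D_τ}` -/
def Dnrm (t τ : ℝ) (g : ℝ → ℝ → ℝ → ℝ) : ℝ := ∑' n : ℕ, Del t τ g n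
/-- `‖g‖_{Y_τ}` -/
def Ynrm (t τ : ℝ) (g : ℝ → ℝ → ℝ → ℝ) : ℝ := ∑' n : ℕ, Yel t τ g n

/-- triple integral over `ℝ² × (0,∞)` -/
def trip (F : ℝ → ℝ → ℝ → ℝ) : ℝ := ∫ x : ℝ, ∫ y : ℝ, ∫ z in Ioi (0 : ℝ), F x y z

/-- `I^α_1` -/
def I1 (t : ℝ) (g : ℝ → ℝ → ℝ → ℝ) (a b : ℕ) : ℝ :=
  -trip fun x y z =>
    thw t 2 z * angR x y ^ (2 * (a + b)) *
      pdh a b (fun x' y' z' => ur t g x' y' z' * rdr g x' y' z') x y z * pdh a b g x y z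

/-- `I^α_2` -/
def I2 (t : ℝ) (g : ℝ → ℝ → ℝ → ℝ) (a b : ℕ) : ℝ :=
  -trip fun x y z =>
    thw t 2 z * angR x y ^ (2 * (a + b)) *
      pdh a b (fun x' y' z' => uzv t g x' y' z' * pdz g x' y' z') x y z * pdh a b g x y z

/-- `I^α_3` -/
def I3 (t : ℝ) (g : ℝ → ℝ → ℝ → ℝ) (a b : ℕ) : ℝ :=
  -trip fun x y z =>
    thw t 2 z * angR x y ^ (2 * (a + b)) *
      pdh a b (fun x' y' z' => ur t g x' y' z' ^ 2) x y z * pdh a b g x y z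

/-- `I^α_4` -/
def I4 (t : ℝ) (g : ℝ → ℝ → ℝ → ℝ) (a b : ℕ) : ℝ :=
  (1 / (2 * angT t)) * trip fun x y z =>
    thw t 2 z * angR x y ^ (2 * (a + b)) *
      pdh a b
        (fun x' y' z' =>
          uzv t g x' y' z' * pdz (fun x'' y'' w => w * phiF t g x'' y'' w) x' y' z') x y z *
      pdh a b g x y z

/-- `I^α_5` -/
def I5 (t : ℝ) (g : ℝ → ℝ → ℝ → ℝ) (a b : ℕ) : ℝ :=
  -(1 / angT t) * trip fun x y z =>
    z * thw t 2 z * angR x y ^ (2 * (a + b)) *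
      pdh a b (fun x' y' z' => ur t g x' y' z' * phiF t g x' y' z') x y z * pdh a b g x y z

/-- `I^α_6` -/
def I6 (t : ℝ) (g : ℝ → ℝ → ℝ → ℝ) (a b : ℕ) : ℝ :=
  -(1 / (2 * angT t)) * trip fun x y z =>
    z * thw t 2 z * angR x y ^ (2 * (a + b)) *
      (∫ s in Ioi z, pdh a b (fun x' y' z' => ur t g x' y' z' ^ 2) x y s) * pdh a b g x y z

/-- `I^α_7` -/
def I7 (t : ℝ) (g : ℝ → ℝ → ℝ → ℝ) (a b : ℕ) : ℝ :=
  (1 / angT t) * trip fun x y z =>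
    z * thw t 2 z * angR x y ^ (2 * (a + b)) *
      (∫ s in Ioi z, pdh a b (fun x' y' z' => pdz (ur t g) x' y' z' * uzv t g x' y' z') x y s) *
      pdh a b g x y z

/-- `∑_{|α| = n} |I^α| τⁿ Mₙ / ‖θ ⟨r⟩ⁿ ∂^α_h g‖_{L²}` (with the convention `x / 0 = 0`) -/
def Qterm (t τ : ℝ) (g : ℝ → ℝ → ℝ → ℝ) (I : ℕ → ℕ → ℝ) (n : ℕ) : ℝ :=
  ∑ a ∈ Finset.range (n + 1), |I a (n - a)| * τ ^ n * Mfac n / L2w t 1 n (pdh a (n - a) g)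

/-- `∂_t` -/
def pdt (G : ℝ → ℝ → ℝ → ℝ → ℝ) (t x y z : ℝ) : ℝ := deriv (fun t' => G t' x y z) t

/-- the good-unknown axially symmetric Prandtl equation at the point `(t, x, y, z)` -/
def GoodEq (G : ℝ → ℝ → ℝ → ℝ → ℝ) (t x y z : ℝ) : Prop :=
  pdt G t x y z
      + ur t (G t) x y z * rdr (G t) x y z
      + uzv t (G t) x y z * pdz (G t) x y z
      - pdz (pdz (G t)) x y z
      + G t x y z / angT t
      + ur t (G t) x y z ^ 2
      - 1 / (2 * angT t) * (uzv t (G t) x y z * pdz (fun x' y' w => w * phiF t (G t) x' y' w) x y z)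
      + z / angT t * (ur t (G t) x y z * phiF t (G t) x y z)
      + z / (2 * angT t) * (∫ s in Ioi z, ur t (G t) x y s ^ 2)
      - z / angT t * (∫ s in Ioi z, pdz (ur t (G t)) x y s * uzv t (G t) x y s) = 0

/-- joint smoothness of a function of three real variables -/
def SmoothThree (f : ℝ → ℝ → ℝ → ℝ) : Prop :=
  ContDiff ℝ (⊤ : ℕ∞) (fun p : ℝ × ℝ × ℝ => f p.1 p.2.1 p.2.2)

/-- directional derivative, in curried form -/
def dirDeriv (v : ℝ × ℝ × ℝ) (f : ℝ → ℝ → ℝ → ℝ) : ℝ → ℝ → ℝ → ℝ := fun x y z =>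
  fderiv ℝ (fun p : ℝ × ℝ × ℝ => f p.1 p.2.1 p.2.2) (x, y, z) v

lemma SmoothThree.hasFDerivAt {f : ℝ → ℝ → ℝ → ℝ} (hf : SmoothThree f) (p : ℝ × ℝ × ℝ) :
    HasFDerivAt (fun p : ℝ × ℝ × ℝ => f p.1 p.2.1 p.2.2)
      (fderiv ℝ (fun p : ℝ × ℝ × ℝ => f p.1 p.2.1 p.2.2) p) p :=
  (ContDiff.differentiable hf (by simp) p).hasFDerivAt

lemma SmoothThree.hasDerivAt_x' {f : ℝ → ℝ → ℝ → ℝ} (hf : SmoothThree f) (x y z : ℝ) :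
    HasDerivAt (fun x' => f x' y z) (dirDeriv (1, 0, 0) f x y z) x := by
  have h : HasDerivAt (fun x' : ℝ => (x', y, z)) ((1 : ℝ), (0 : ℝ), (0 : ℝ)) x :=
    (hasDerivAt_id x).prodMk ((hasDerivAt_const x y).prodMk (hasDerivAt_const x z))
  exact (hf.hasFDerivAt (x, y, z)).comp_hasDerivAt x h

lemma SmoothThree.hasDerivAt_y' {f : ℝ → ℝ → ℝ → ℝ} (hf : SmoothThree f) (x y z : ℝ) :
    HasDerivAt (fun y' => f x y' z) (dirDeriv (0, 1, 0) f x y z) y := by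
  have h : HasDerivAt (fun y' : ℝ => (x, y', z)) ((0 : ℝ), (1 : ℝ), (0 : ℝ)) y :=
    (hasDerivAt_const y x).prodMk ((hasDerivAt_id y).prodMk (hasDerivAt_const y z))
  exact (hf.hasFDerivAt (x, y, z)).comp_hasDerivAt y h

lemma SmoothThree.hasDerivAt_z' {f : ℝ → ℝ → ℝ → ℝ} (hf : SmoothThree f) (x y z : ℝ) :
    HasDerivAt (fun z' => f x y z') (dirDeriv (0, 0, 1) f x y z) z := by
  have h : HasDerivAt (fun z' : ℝ => (x, y, z')) ((0 : ℝ), (0 : ℝ), (1 : ℝ)) z :=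
    (hasDerivAt_const z x).prodMk ((hasDerivAt_const z y).prodMk (hasDerivAt_id z))
  exact (hf.hasFDerivAt (x, y, z)).comp_hasDerivAt z h

lemma SmoothThree.pdx_eq {f : ℝ → ℝ → ℝ → ℝ} (hf : SmoothThree f) :
    pdx f = dirDeriv (1, 0, 0) f := by
  ext x y z; exact (hf.hasDerivAt_x' x y z).deriv

lemma SmoothThree.pdy_eq {f : ℝ → ℝ → ℝ → ℝ} (hf : SmoothThree f) :
    pdy f = dirDeriv (0, 1, 0) f := by
  ext x y z; exact (hf.hasDerivAt_y' x y z).deriv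

lemma SmoothThree.pdz_eq {f : ℝ → ℝ → ℝ → ℝ} (hf : SmoothThree f) :
    pdz f = dirDeriv (0, 0, 1) f := by
  ext x y z; exact (hf.hasDerivAt_z' x y z).deriv

lemma SmoothThree.dirDeriv {f : ℝ → ℝ → ℝ → ℝ} (hf : SmoothThree f) (v : ℝ × ℝ × ℝ) :
    SmoothThree (dirDeriv v f) := by
  have h : ContDiff ℝ (⊤ : ℕ∞) (fderiv ℝ (fun p : ℝ × ℝ × ℝ => f p.1 p.2.1 p.2.2)) :=
    ContDiff.fderiv_right hf (by simp)
  exact h.clm_apply contDiff_const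

lemma SmoothThree.dirDeriv_comm {f : ℝ → ℝ → ℝ → ℝ} (hf : SmoothThree f) (v w : ℝ × ℝ × ℝ) :
    _root_.dirDeriv v (_root_.dirDeriv w f) = _root_.dirDeriv w (_root_.dirDeriv v f) := by
  ext x y z
  have h1 : ContDiff ℝ (⊤ : ℕ∞) (fderiv ℝ (fun p : ℝ × ℝ × ℝ => f p.1 p.2.1 p.2.2)) :=
    ContDiff.fderiv_right hf (by simp)
  have hd := fun p => h1.differentiable (by simp) p
  have hs : IsSymmSndFDerivAt ℝ (fun p : ℝ × ℝ × ℝ => f p.1 p.2.1 p.2.2) (x, y, z) :=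
    ContDiffAt.isSymmSndFDerivAt (n := (⊤ : ℕ∞)) (ContDiff.contDiffAt hf)
      (by simpa using WithTop.coe_le_coe.2 (le_top : (2 : ℕ∞) ≤ ⊤))
  have key : ∀ v w : ℝ × ℝ × ℝ, _root_.dirDeriv v (_root_.dirDeriv w f) x y z =
      fderiv ℝ (fderiv ℝ (fun p : ℝ × ℝ × ℝ => f p.1 p.2.1 p.2.2)) (x, y, z) v w := by
    intro v w
    change fderiv ℝ (fun p : ℝ × ℝ × ℝ =>
      fderiv ℝ (fun p : ℝ × ℝ × ℝ => f p.1 p.2.1 p.2.2) p w) (x, y, z) v = _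
    rw [fderiv_clm_apply (hd _) (differentiableAt_const _)]
    simp
  rw [key, key, hs.eq]

lemma SmoothThree.pdx {f : ℝ → ℝ → ℝ → ℝ} (hf : SmoothThree f) : SmoothThree (pdx f) := by
  rw [hf.pdx_eq]; exact hf.dirDeriv _

lemma SmoothThree.pdy {f : ℝ → ℝ → ℝ → ℝ} (hf : SmoothThree f) : SmoothThree (pdy f) := by
  rw [hf.pdy_eq]; exact hf.dirDeriv _

lemma SmoothThree.pdz {f : ℝ → ℝ → ℝ → ℝ} (hf : SmoothThree f) : SmoothThree (pdz f) := by
  rw [hf.pdz_eq]; exact hf.dirDeriv _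

lemma SmoothThree.hasDerivAt_x {f : ℝ → ℝ → ℝ → ℝ} (hf : SmoothThree f) (x y z : ℝ) :
    HasDerivAt (fun x' => f x' y z) (_root_.pdx f x y z) x := by
  rw [hf.pdx_eq]; exact hf.hasDerivAt_x' x y z

lemma SmoothThree.hasDerivAt_y {f : ℝ → ℝ → ℝ → ℝ} (hf : SmoothThree f) (x y z : ℝ) :
    HasDerivAt (fun y' => f x y' z) (_root_.pdy f x y z) y := by
  rw [hf.pdy_eq]; exact hf.hasDerivAt_y' x y z

lemma SmoothThree.hasDerivAt_z {f : ℝ → ℝ → ℝ → ℝ} (hf : SmoothThree f) (x y z : ℝ) :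
    HasDerivAt (fun z' => f x y z') (_root_.pdz f x y z) z := by
  rw [hf.pdz_eq]; exact hf.hasDerivAt_z' x y z

lemma SmoothThree.continuous {f : ℝ → ℝ → ℝ → ℝ} (hf : SmoothThree f) :
    Continuous (fun p : ℝ × ℝ × ℝ => f p.1 p.2.1 p.2.2) := ContDiff.continuous hf

lemma SmoothThree.pdz_pdx {f : ℝ → ℝ → ℝ → ℝ} (hf : SmoothThree f) :
    _root_.pdz (_root_.pdx f) = _root_.pdx (_root_.pdz f) := by
  rw [hf.pdx.pdz_eq, hf.pdz.pdx_eq, hf.pdx_eq, hf.pdz_eq, hf.dirDeriv_comm]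

lemma SmoothThree.pdz_pdy {f : ℝ → ℝ → ℝ → ℝ} (hf : SmoothThree f) :
    _root_.pdz (_root_.pdy f) = _root_.pdy (_root_.pdz f) := by
  rw [hf.pdy.pdz_eq, hf.pdz.pdy_eq, hf.pdy_eq, hf.pdz_eq, hf.dirDeriv_comm]

lemma SmoothThree.pdy_pdx {f : ℝ → ℝ → ℝ → ℝ} (hf : SmoothThree f) :
    _root_.pdy (_root_.pdx f) = _root_.pdx (_root_.pdy f) := by
  rw [hf.pdx.pdy_eq, hf.pdy.pdx_eq, hf.pdx_eq, hf.pdy_eq, hf.dirDeriv_comm]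

lemma SmoothThree.pdx_iterate {f : ℝ → ℝ → ℝ → ℝ} (hf : SmoothThree f) (a : ℕ) :
    SmoothThree (_root_.pdx^[a] f) := by
  induction a with
  | zero => exact hf
  | succ a ih => rw [Function.iterate_succ_apply']; exact ih.pdx

lemma SmoothThree.pdy_iterate {f : ℝ → ℝ → ℝ → ℝ} (hf : SmoothThree f) (b : ℕ) :
    SmoothThree (_root_.pdy^[b] f) := by
  induction b with
  | zero => exact hf
  | succ b ih => rw [Function.iterate_succ_apply']; exact ih.pdy

lemma SmoothThree.pdh {f : ℝ → ℝ → ℝ → ℝ} (hf : SmoothThree f) (a b : ℕ) :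
    SmoothThree (pdh a b f) := (hf.pdy_iterate b).pdx_iterate a

lemma pdx_pdh (a b : ℕ) (f : ℝ → ℝ → ℝ → ℝ) : pdx (pdh a b f) = pdh (a + 1) b f := by
  simp only [pdh, Function.iterate_succ_apply']

lemma SmoothThree.pdy_pdh {f : ℝ → ℝ → ℝ → ℝ} (hf : SmoothThree f) (a b : ℕ) :
    _root_.pdy (_root_.pdh a b f) = _root_.pdh a (b + 1) f := by
  induction a with
  | zero => simp only [_root_.pdh, Function.iterate_zero, id, Function.iterate_succ_apply']
  | succ a ih => rw [← pdx_pdh, ← pdx_pdh, (hf.pdh a b).pdy_pdx, ih]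

lemma SmoothThree.pdz_pdh {f : ℝ → ℝ → ℝ → ℝ} (hf : SmoothThree f) (a b : ℕ) :
    _root_.pdz (_root_.pdh a b f) = _root_.pdh a b (_root_.pdz f) := by
  induction a with
  | zero =>
    induction b with
    | zero => rfl
    | succ b ih => rw [← hf.pdy_pdh, ← hf.pdz.pdy_pdh, (hf.pdh 0 b).pdz_pdy, ih]
  | succ a ih => rw [← pdx_pdh, ← pdx_pdh, (hf.pdh a b).pdz_pdx, ih]

lemma hasDerivAt_intervalIntegral_param {F F' : ℝ → ℝ → ℝ} (a b : ℝ)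
    (hF : Continuous (fun p : ℝ × ℝ => F p.1 p.2)) (hF' : Continuous (fun p : ℝ × ℝ => F' p.1 p.2))
    (hd : ∀ x s, HasDerivAt (fun x' => F x' s) (F' x s) x) (x : ℝ) :
    HasDerivAt (fun x' => ∫ s in a..b, F x' s) (∫ s in a..b, F' x s) x := by
  obtain ⟨C, hC⟩ := ((isCompact_Icc (a := x - 1) (b := x + 1)).prod
    (isCompact_uIcc (a := a) (b := b))).exists_bound_of_continuousOn hF'.continuousOn
  refine (intervalIntegral.hasDerivAt_integral_of_dominated_loc_of_deriv_le
    (bound := fun _ => C) (Icc_mem_nhds (a := x - 1) (b := x + 1) (by linarith) (by linarith))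
    (Eventually.of_forall fun x' => ?_) ?_ ?_ ?_ ?_ ?_).2
  · exact (hF.comp (Continuous.prodMk_right x')).aestronglyMeasurable
  · exact (hF.comp (Continuous.prodMk_right x)).intervalIntegrable _ _
  · exact (hF'.comp (Continuous.prodMk_right x)).aestronglyMeasurable
  · exact Eventually.of_forall fun s hs x' hx' => hC (x', s) ⟨hx', uIoc_subset_uIcc hs⟩
  · simp
  · exact Eventually.of_forall fun s _ x' _ => hd x' s

lemma SmoothThree.hasDerivAt_phiF_x {g : ℝ → ℝ → ℝ → ℝ} (hg : SmoothThree g) (t x y z : ℝ) :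
    HasDerivAt (fun x' => phiF t g x' y z) (phiF t (_root_.pdx g) x y z) x := by
  refine HasDerivAt.const_mul _ (hasDerivAt_intervalIntegral_param
    (F := fun x s => g x y s * Real.exp (s ^ 2 / (4 * angT t)))
    (F' := fun x s => _root_.pdx g x y s * Real.exp (s ^ 2 / (4 * angT t))) 0 z ?_ ?_ ?_ x)
  · exact (hg.continuous.comp (by fun_prop : Continuous fun p : ℝ × ℝ => (p.1, y, p.2))).mul
      (by fun_prop)
  · exact (hg.pdx.continuous.comp (by fun_prop : Continuous fun p : ℝ × ℝ => (p.1, y, p.2))).mul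
      (by fun_prop)
  · exact fun x s => (hg.hasDerivAt_x x y s).mul_const _

lemma SmoothThree.hasDerivAt_phiF_y {g : ℝ → ℝ → ℝ → ℝ} (hg : SmoothThree g) (t x y z : ℝ) :
    HasDerivAt (fun y' => phiF t g x y' z) (phiF t (_root_.pdy g) x y z) y := by
  refine HasDerivAt.const_mul _ (hasDerivAt_intervalIntegral_param
    (F := fun y s => g x y s * Real.exp (s ^ 2 / (4 * angT t)))
    (F' := fun y s => _root_.pdy g x y s * Real.exp (s ^ 2 / (4 * angT t))) 0 z ?_ ?_ ?_ y)
  · exact (hg.continuous.comp (by fun_prop : Continuous fun p : ℝ × ℝ => (x, p.1, p.2))).mul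
      (by fun_prop)
  · exact (hg.pdy.continuous.comp (by fun_prop : Continuous fun p : ℝ × ℝ => (x, p.1, p.2))).mul
      (by fun_prop)
  · exact fun y s => (hg.hasDerivAt_y x y s).mul_const _

lemma SmoothThree.continuous_phiF {g : ℝ → ℝ → ℝ → ℝ} (hg : SmoothThree g) (t : ℝ) :
    Continuous (fun p : ℝ × ℝ × ℝ => phiF t g p.1 p.2.1 p.2.2) := by
  refine Continuous.mul (by fun_prop) ?_
  refine intervalIntegral.continuous_parametric_intervalIntegral_of_continuous ?_ (by fun_prop)
  exact (hg.continuous.comp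
    (by fun_prop : Continuous fun q : (ℝ × ℝ × ℝ) × ℝ => (q.1.1, q.1.2.1, q.2))).mul (by fun_prop)

lemma SmoothThree.ur_eq {g : ℝ → ℝ → ℝ → ℝ} (hg : SmoothThree g) (t x y z : ℝ) :
    ur t g x y z = g x y z - z / (2 * angT t) * phiF t g x y z := by
  have hc : Continuous fun s => g x y s * Real.exp (s ^ 2 / (4 * angT t)) :=
    (hg.continuous.comp (by fun_prop : Continuous fun s : ℝ => (x, y, s))).mul (by fun_prop)
  have h1 := intervalIntegral.integral_hasDerivAt_right (hc.intervalIntegrable 0 z)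
    (hc.stronglyMeasurableAtFilter _ _) hc.continuousAt
  have h2 : HasDerivAt (fun z : ℝ => Real.exp (-(z ^ 2) / (4 * angT t)))
      (Real.exp (-(z ^ 2) / (4 * angT t)) * (-(2 * z) / (4 * angT t))) z := by
    simpa using (((hasDerivAt_pow 2 z).neg).div_const (4 * angT t)).exp
  have h3 := (h2.mul h1).deriv
  have h4 : Real.exp (-(z ^ 2) / (4 * angT t)) * Real.exp (z ^ 2 / (4 * angT t)) = 1 := by
    rw [← Real.exp_add, neg_div, neg_add_cancel, Real.exp_zero]
  have h5 : -(2 * z) / (4 * angT t) = - (z / (2 * angT t)) := by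
    rw [neg_div, show (4 : ℝ) * angT t = 2 * (2 * angT t) by ring, mul_div_mul_left _ _ two_ne_zero]
  change deriv _ z = _
  refine h3.trans ?_
  simp only [phiF]
  rw [h5]
  linear_combination (g x y z) * h4

lemma SmoothThree.hasDerivAt_ur_x {g : ℝ → ℝ → ℝ → ℝ} (hg : SmoothThree g) (t x y z : ℝ) :
    HasDerivAt (fun x' => ur t g x' y z) (ur t (_root_.pdx g) x y z) x := by
  simp only [hg.ur_eq, hg.pdx.ur_eq]
  exact (hg.hasDerivAt_x x y z).sub ((hg.hasDerivAt_phiF_x t x y z).const_mul _)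

lemma SmoothThree.hasDerivAt_ur_y {g : ℝ → ℝ → ℝ → ℝ} (hg : SmoothThree g) (t x y z : ℝ) :
    HasDerivAt (fun y' => ur t g x y' z) (ur t (_root_.pdy g) x y z) y := by
  simp only [hg.ur_eq, hg.pdy.ur_eq]
  exact (hg.hasDerivAt_y x y z).sub ((hg.hasDerivAt_phiF_y t x y z).const_mul _)

lemma SmoothThree.continuous_ur {g : ℝ → ℝ → ℝ → ℝ} (hg : SmoothThree g) (t : ℝ) :
    Continuous (fun p : ℝ × ℝ × ℝ => ur t g p.1 p.2.1 p.2.2) := by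
  simp only [hg.ur_eq]
  exact hg.continuous.sub (Continuous.mul (by fun_prop) (hg.continuous_phiF t))

lemma SmoothThree.iteratedDeriv_ur_x {g : ℝ → ℝ → ℝ → ℝ} (hg : SmoothThree g) (t y z : ℝ)
    (k : ℕ) : iteratedDeriv k (fun x => ur t g x y z) = fun x => ur t (_root_.pdx^[k] g) x y z := by
  induction k with
  | zero => simp
  | succ k ih =>
    rw [iteratedDeriv_succ, ih, Function.iterate_succ_apply']
    ext x
    exact ((hg.pdx_iterate k).hasDerivAt_ur_x t x y z).deriv

lemma SmoothThree.iteratedDeriv_ur_y {g : ℝ → ℝ → ℝ → ℝ} (hg : SmoothThree g) (t x z : ℝ)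
    (k : ℕ) : iteratedDeriv k (fun y => ur t g x y z) = fun y => ur t (_root_.pdy^[k] g) x y z := by
  induction k with
  | zero => simp
  | succ k ih =>
    rw [iteratedDeriv_succ, ih, Function.iterate_succ_apply']
    ext y
    exact ((hg.pdy_iterate k).hasDerivAt_ur_y t x y z).deriv

lemma SmoothThree.contDiff_ur_x {g : ℝ → ℝ → ℝ → ℝ} (hg : SmoothThree g) (t y z : ℝ) :
    ContDiff ℝ (⊤ : ℕ∞) (fun x => ur t g x y z) := by
  refine contDiff_of_differentiable_iteratedDeriv fun m _ x => ?_
  rw [hg.iteratedDeriv_ur_x]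
  exact ((hg.pdx_iterate m).hasDerivAt_ur_x t x y z).differentiableAt

lemma SmoothThree.contDiff_ur_y {g : ℝ → ℝ → ℝ → ℝ} (hg : SmoothThree g) (t x z : ℝ) :
    ContDiff ℝ (⊤ : ℕ∞) (fun y => ur t g x y z) := by
  refine contDiff_of_differentiable_iteratedDeriv fun m _ y => ?_
  rw [hg.iteratedDeriv_ur_y]
  exact ((hg.pdy_iterate m).hasDerivAt_ur_y t x y z).differentiableAt

lemma pdx_iterate_eq (f : ℝ → ℝ → ℝ → ℝ) (k : ℕ) (x y z : ℝ) :
    pdx^[k] f x y z = iteratedDeriv k (fun x' => f x' y z) x := by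
  induction k generalizing x with
  | zero => simp
  | succ k ih =>
    rw [Function.iterate_succ_apply', iteratedDeriv_succ]
    simp only [pdx, ih]

lemma pdy_iterate_eq (f : ℝ → ℝ → ℝ → ℝ) (k : ℕ) (x y z : ℝ) :
    pdy^[k] f x y z = iteratedDeriv k (fun y' => f x y' z) y := by
  induction k generalizing y with
  | zero => simp
  | succ k ih =>
    rw [Function.iterate_succ_apply', iteratedDeriv_succ]
    simp only [pdy, ih]

/-- Leibniz formula for the square of `u^r`. -/
lemma SmoothThree.pdh_ur_sq {g : ℝ → ℝ → ℝ → ℝ} (hg : SmoothThree g) (t : ℝ) (a b : ℕ)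
    (x y z : ℝ) :
    _root_.pdh a b (fun x' y' z' => ur t g x' y' z' ^ 2) x y z =
      ∑ j ∈ Finset.range (b + 1), ∑ i ∈ Finset.range (a + 1),
        (b.choose j : ℝ) * (a.choose i : ℝ) *
          (ur t (_root_.pdh i j g) x y z * ur t (_root_.pdh (a - i) (b - j) g) x y z) := by
  have hy : _root_.pdy^[b] (fun x' y' z' => ur t g x' y' z' ^ 2) = fun x y z =>
      ∑ j ∈ Finset.range (b + 1), (b.choose j : ℝ) *
        (ur t (_root_.pdy^[j] g) x y z * ur t (_root_.pdy^[b - j] g) x y z) := by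
    ext x y z
    rw [pdy_iterate_eq]
    simp only [pow_two]
    have h := (hg.contDiff_ur_y t x z).of_le (m := (b : ℕ∞)) (mod_cast le_top)
    rw [iteratedDeriv_fun_mul (ContDiff.contDiffAt h) (ContDiff.contDiffAt h)]
    simp only [hg.iteratedDeriv_ur_y, mul_assoc]
  rw [_root_.pdh, hy, pdx_iterate_eq]
  have hc : ∀ j, ContDiff ℝ (a : ℕ∞) (fun x => ur t (_root_.pdy^[j] g) x y z) := fun j =>
    ((hg.pdy_iterate j).contDiff_ur_x t y z).of_le (mod_cast le_top)
  rw [iteratedDeriv_fun_sum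
    (fun j _ => ContDiff.contDiffAt (contDiff_const.mul ((hc j).mul (hc (b - j)))))]
  refine Finset.sum_congr rfl fun j _ => ?_
  rw [iteratedDeriv_const_mul_field,
    iteratedDeriv_fun_mul (ContDiff.contDiffAt (hc _)) (ContDiff.contDiffAt (hc _)),
    Finset.mul_sum]
  refine Finset.sum_congr rfl fun i _ => ?_
  rw [(hg.pdy_iterate _).iteratedDeriv_ur_x, (hg.pdy_iterate _).iteratedDeriv_ur_x]
  simp only [_root_.pdh]
  ring

lemma SmoothThree.continuous_pdh_ur_sq {g : ℝ → ℝ → ℝ → ℝ} (hg : SmoothThree g) (t : ℝ)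
    (a b : ℕ) : Continuous (fun p : ℝ × ℝ × ℝ =>
      _root_.pdh a b (fun x' y' z' => ur t g x' y' z' ^ 2) p.1 p.2.1 p.2.2) := by
  simp only [hg.pdh_ur_sq]
  refine continuous_finsetSum _ fun j _ => continuous_finsetSum _ fun i _ => ?_
  exact continuous_const.mul (((hg.pdh _ _).continuous_ur t).mul ((hg.pdh _ _).continuous_ur t))

lemma Real.enorm_sq_eq_ofReal (u : ℝ) : ‖u‖ₑ ^ 2 = ENNReal.ofReal (u ^ 2) := by
  rw [← enorm_pow, Real.enorm_eq_ofReal (sq_nonneg u)]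

lemma enorm_sub_sq_le (u v : ℝ) : ‖u - v‖ₑ ^ 2 ≤ 2 * ‖u‖ₑ ^ 2 + 2 * ‖v‖ₑ ^ 2 := by
  simp only [Real.enorm_sq_eq_ofReal]
  rw [← mul_add, ← ENNReal.ofReal_add (sq_nonneg _) (sq_nonneg _),
    show (2 : ENNReal) = ENNReal.ofReal 2 by simp, ← ENNReal.ofReal_mul zero_le_two]
  exact ENNReal.ofReal_le_ofReal (by nlinarith [sq_nonneg (u + v)])

lemma sq_lintegral_mul_le {α : Type*} [MeasurableSpace α] (μ : Measure α) {f g : α → ENNReal}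
    (hf : AEMeasurable f μ) (hg : AEMeasurable g μ) :
    (∫⁻ a, f a * g a ∂μ) ^ 2 ≤ (∫⁻ a, f a ^ 2 ∂μ) * ∫⁻ a, g a ^ 2 ∂μ := by
  have h := ENNReal.lintegral_mul_le_Lp_mul_Lq μ Real.HolderConjugate.two_two hf hg
  simp only [Pi.mul_apply, ENNReal.rpow_ofNat] at h
  calc (∫⁻ a, f a * g a ∂μ) ^ 2
      ≤ ((∫⁻ a, f a ^ 2 ∂μ) ^ (1 / 2 : ℝ) * (∫⁻ a, g a ^ 2 ∂μ) ^ (1 / 2 : ℝ)) ^ 2 := by gcongr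
    _ = (∫⁻ a, f a ^ 2 ∂μ) * ∫⁻ a, g a ^ 2 ∂μ := by
      rw [mul_pow, ← ENNReal.rpow_natCast, ← ENNReal.rpow_natCast, ← ENNReal.rpow_mul,
        ← ENNReal.rpow_mul]
      norm_num

/-- Schur's test. -/
lemma lintegral_sq_kernel_le {α β : Type*} [MeasurableSpace α] [MeasurableSpace β]
    (μ : Measure α) (ν : Measure β) [SFinite μ] [SFinite ν] {k : α → β → ENNReal}
    (hk : Measurable (Function.uncurry k)) {h : β → ENNReal} (hh : Measurable h) {A B : ENNReal}
    (hA : ∀ᵐ a ∂μ, ∫⁻ b, k a b ∂ν ≤ A) (hB : ∀ᵐ b ∂ν, ∫⁻ a, k a b ∂μ ≤ B) :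
    ∫⁻ a, (∫⁻ b, k a b * h b ∂ν) ^ 2 ∂μ ≤ A * B * ∫⁻ b, h b ^ 2 ∂ν := by
  have hka : ∀ a, Measurable (k a) := fun a => hk.comp measurable_prodMk_left
  have h1 : ∀ᵐ a ∂μ, (∫⁻ b, k a b * h b ∂ν) ^ 2 ≤ A * ∫⁻ b, k a b * h b ^ 2 ∂ν := by
    filter_upwards [hA] with a ha
    have h2 := sq_lintegral_mul_le ν (f := fun b => k a b ^ (1 / 2 : ℝ))
      (g := fun b => k a b ^ (1 / 2 : ℝ) * h b)
      ((hka a).pow_const _).aemeasurable (((hka a).pow_const _).mul hh).aemeasurable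
    have h3 : ∀ c : ENNReal, c ^ (1 / 2 : ℝ) * c ^ (1 / 2 : ℝ) = c := fun c => by
      rw [← ENNReal.rpow_add_of_nonneg _ _ (by norm_num) (by norm_num)]; norm_num
    have h4 : ∀ c : ENNReal, (c ^ (1 / 2 : ℝ)) ^ 2 = c := fun c => by rw [pow_two, h3]
    simp only [← mul_assoc, h3, mul_pow, h4] at h2
    exact h2.trans (by gcongr)
  calc ∫⁻ a, (∫⁻ b, k a b * h b ∂ν) ^ 2 ∂μ
      ≤ ∫⁻ a, A * ∫⁻ b, k a b * h b ^ 2 ∂ν ∂μ := lintegral_mono_ae h1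
    _ = A * ∫⁻ a, ∫⁻ b, k a b * h b ^ 2 ∂ν ∂μ :=
      lintegral_const_mul _ (Measurable.lintegral_prod_right'
        (f := fun p : α × β => k p.1 p.2 * h p.2 ^ 2)
        (hk.mul ((hh.pow_const 2).comp measurable_snd)))
    _ = A * ∫⁻ b, ∫⁻ a, k a b * h b ^ 2 ∂μ ∂ν := by
      rw [lintegral_lintegral_swap]
      exact (hk.mul ((hh.pow_const 2).comp measurable_snd)).aemeasurable
    _ = A * ∫⁻ b, (∫⁻ a, k a b ∂μ) * h b ^ 2 ∂ν := by
      congr 1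
      refine lintegral_congr fun b => ?_
      exact lintegral_mul_const _ (hk.comp measurable_prodMk_right)
    _ ≤ A * ∫⁻ b, B * h b ^ 2 ∂ν := by
      gcongr 1
      refine lintegral_mono_ae ?_
      filter_upwards [hB] with b hb
      gcongr
    _ = A * B * ∫⁻ b, h b ^ 2 ∂ν := by
      rw [lintegral_const_mul _ (hh.pow_const 2), mul_assoc]

lemma enorm_sq_le_lintegral_Ioc {f f' : ℝ → ℝ} (hd : ∀ x, HasDerivAt f (f' x) x)
    (hf' : Continuous f') (x₀ : ℝ) :
    ‖f x₀‖ₑ ^ 2 ≤ 2 * ∫⁻ x in Ioc x₀ (x₀ + 1), (‖f x‖ₑ ^ 2 + ‖f' x‖ₑ ^ 2) := by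
  have hf : Continuous f := continuous_iff_continuousAt.2 fun x => (hd x).continuousAt
  have hc : Continuous fun x => f x ^ 2 + f' x ^ 2 := by fun_prop
  have hle : x₀ ≤ x₀ + 1 := by linarith
  set J := ∫ x in x₀..(x₀ + 1), (f x ^ 2 + f' x ^ 2) with hJ
  have h1 : ∀ s ∈ Icc x₀ (x₀ + 1), f x₀ ^ 2 ≤ f s ^ 2 + J := by
    intro s hs
    have hd2 : ∀ x ∈ uIcc x₀ s, HasDerivAt (fun x => f x ^ 2) (2 * f x * f' x) x := fun x _ => by
      simpa using! (hd x).pow 2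
    have h2 := intervalIntegral.integral_eq_sub_of_hasDerivAt hd2
      (Continuous.intervalIntegrable (by fun_prop) _ _)
    have h3 : -∫ x in x₀..s, 2 * f x * f' x ≤ ∫ x in x₀..s, (f x ^ 2 + f' x ^ 2) := by
      rw [← intervalIntegral.integral_neg]
      refine intervalIntegral.integral_mono hs.1 (Continuous.intervalIntegrable (by fun_prop) _ _)
        (hc.intervalIntegrable _ _) fun x => ?_
      nlinarith [sq_nonneg (f x + f' x)]
    have h4 : ∫ x in x₀..s, (f x ^ 2 + f' x ^ 2) ≤ J :=
      intervalIntegral.integral_mono_interval le_rfl hs.1 hs.2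
        (Eventually.of_forall fun x => by positivity) (hc.intervalIntegrable _ _)
    linarith
  have h5 : f x₀ ^ 2 ≤ 2 * J := by
    have h6 := intervalIntegral.integral_mono_on hle
      (intervalIntegrable_const (μ := volume))
      ((by fun_prop : Continuous fun s => f s ^ 2 + J).intervalIntegrable _ _) h1
    have h7 : ∫ s in x₀..(x₀ + 1), (f s ^ 2 + J) = (∫ s in x₀..(x₀ + 1), f s ^ 2) + J := by
      rw [intervalIntegral.integral_add (Continuous.intervalIntegrable (by fun_prop) _ _)
        (Continuous.intervalIntegrable (by fun_prop) _ _)]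
      simp
    have h8 : ∫ s in x₀..(x₀ + 1), f s ^ 2 ≤ J :=
      intervalIntegral.integral_mono hle (Continuous.intervalIntegrable (by fun_prop) _ _)
        (hc.intervalIntegrable _ _) fun x => by simpa using sq_nonneg (f' x)
    rw [h7] at h6
    simp at h6
    linarith
  have h9 : ENNReal.ofReal J = ∫⁻ x in Ioc x₀ (x₀ + 1), (‖f x‖ₑ ^ 2 + ‖f' x‖ₑ ^ 2) := by
    rw [hJ, intervalIntegral.integral_of_le hle, ofReal_integral_eq_lintegral_ofReal
      (hc.intervalIntegrable x₀ (x₀ + 1)).1 (Eventually.of_forall fun x => by positivity)]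
    simp only [Real.enorm_sq_eq_ofReal, ENNReal.ofReal_add (sq_nonneg _) (sq_nonneg _)]
  rw [← h9, Real.enorm_sq_eq_ofReal, show (2 : ENNReal) = ENNReal.ofReal 2 by simp,
    ← ENNReal.ofReal_mul zero_le_two]
  exact ENNReal.ofReal_le_ofReal h5

/-- A one-dimensional Sobolev bound integrating away from the origin. -/
lemma enorm_sq_le_lintegral_outward {f f' : ℝ → ℝ} (hd : ∀ x, HasDerivAt f (f' x) x)
    (hf' : Continuous f') (x₀ : ℝ) :
    ‖f x₀‖ₑ ^ 2 ≤ 2 * ∫⁻ x in {x | |x₀| ≤ |x|}, (‖f x‖ₑ ^ 2 + ‖f' x‖ₑ ^ 2) := by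
  rcases le_total 0 x₀ with h0 | h0
  · refine (enorm_sq_le_lintegral_Ioc hd hf' x₀).trans ?_
    gcongr
    intro x hx
    change |x₀| ≤ |x|
    rw [abs_of_nonneg h0]
    exact hx.1.le.trans (le_abs_self x)
  · have hd' : ∀ x, HasDerivAt (fun x => f (-x)) (-f' (-x)) x := fun x => by
      simpa using! (hd (-x)).comp x (hasDerivAt_neg x)
    have h := enorm_sq_le_lintegral_Ioc hd' (by fun_prop) (-x₀)
    simp only [neg_neg, enorm_neg] at h
    refine h.trans ?_
    have hs : MeasurableSet {x : ℝ | |x₀| ≤ |x|} := measurableSet_le (by fun_prop) (by fun_prop)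
    rw [← lintegral_indicator hs, ← lintegral_neg_eq_self (indicator _ _),
      ← lintegral_indicator measurableSet_Ioc]
    gcongr with x
    by_cases hx : x ∈ Ioc (-x₀) (-x₀ + 1)
    · have hx' : -x ∈ {x : ℝ | |x₀| ≤ |x|} := by
        change |x₀| ≤ |-x|
        rw [abs_of_nonpos h0, abs_neg]
        exact hx.1.le.trans (le_abs_self x)
      rw [indicator_of_mem hx, indicator_of_mem hx']
    · rw [indicator_of_notMem hx]
      exact zero_le

lemma enorm_sq_le_lintegral_outward₂ {f fx fy fxy : ℝ → ℝ → ℝ}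
    (hdx : ∀ x y, HasDerivAt (fun x => f x y) (fx x y) x)
    (hdy : ∀ x y, HasDerivAt (fun y => f x y) (fy x y) y)
    (hdxy : ∀ x y, HasDerivAt (fun y => fx x y) (fxy x y) y)
    (hfx : Continuous fun p : ℝ × ℝ => fx p.1 p.2) (hfy : Continuous fun p : ℝ × ℝ => fy p.1 p.2)
    (hfxy : Continuous fun p : ℝ × ℝ => fxy p.1 p.2) (x₀ y₀ : ℝ) :
    ‖f x₀ y₀‖ₑ ^ 2 ≤ 4 * ∫⁻ x in {x | |x₀| ≤ |x|}, ∫⁻ y in {y | |y₀| ≤ |y|},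
      ((‖f x y‖ₑ ^ 2 + ‖fy x y‖ₑ ^ 2) + (‖fx x y‖ₑ ^ 2 + ‖fxy x y‖ₑ ^ 2)) := by
  have h1 := enorm_sq_le_lintegral_outward (fun x => hdx x y₀)
    (hfx.comp (Continuous.prodMk_left y₀)) x₀
  have hfyx : ∀ x, Continuous (fy x) := fun x => hfy.comp (Continuous.prodMk_right x)
  have hfxyx : ∀ x, Continuous (fxy x) := fun x => hfxy.comp (Continuous.prodMk_right x)
  have hfc : ∀ x, Continuous (f x) := fun x =>
    continuous_iff_continuousAt.2 fun y => (hdy x y).continuousAt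
  calc ‖f x₀ y₀‖ₑ ^ 2
      ≤ 2 * ∫⁻ x in {x | |x₀| ≤ |x|}, (‖f x y₀‖ₑ ^ 2 + ‖fx x y₀‖ₑ ^ 2) := h1
    _ ≤ 2 * ∫⁻ x in {x | |x₀| ≤ |x|}, 2 * ∫⁻ y in {y | |y₀| ≤ |y|},
          ((‖f x y‖ₑ ^ 2 + ‖fy x y‖ₑ ^ 2) + (‖fx x y‖ₑ ^ 2 + ‖fxy x y‖ₑ ^ 2)) := by
      gcongr 2 with x
      have hm : Measurable fun y => ‖f x y‖ₑ ^ 2 + ‖fy x y‖ₑ ^ 2 :=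
        ((hfc x).enorm.measurable.pow_const 2).add ((hfyx x).enorm.measurable.pow_const 2)
      rw [lintegral_add_left hm, mul_add]
      exact add_le_add (enorm_sq_le_lintegral_outward (hdy x) (hfyx x) y₀)
        (enorm_sq_le_lintegral_outward (hdxy x) (hfxyx x) y₀)
    _ = _ := by
      rw [lintegral_const_mul' _ _ (by simp), ← mul_assoc]
      norm_num

/-- the kernel of the Hardy-type operator relating `θ (z / (2T)) φ` to `θ g` -/
def hardyKernel (T z s : ℝ) : ENNReal :=
  if 0 < s ∧ s < z then ENNReal.ofReal (z / (2 * T) * Real.exp (-(z ^ 2 - s ^ 2) / (8 * T))) else 0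

lemma measurable_hardyKernel (T : ℝ) : Measurable (Function.uncurry (hardyKernel T)) := by
  refine Measurable.ite ?_ ?_ measurable_const
  · exact (measurableSet_lt measurable_const measurable_snd).inter
      (measurableSet_lt measurable_snd measurable_fst)
  · exact (Continuous.measurable (by fun_prop)).ennreal_ofReal

lemma lintegral_hardyKernel_fst_le {T : ℝ} (hT : 0 < T) (s : ℝ) :
    ∫⁻ z, hardyKernel T z s ≤ 2 := by
  rcases le_or_gt s 0 with hs | hs
  · simp [hardyKernel, not_lt.2 hs]
  have hd : ∀ z ∈ Ici s, HasDerivAt (fun z => -2 * Real.exp (-(z ^ 2 - s ^ 2) / (8 * T)))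
      (z / (2 * T) * Real.exp (-(z ^ 2 - s ^ 2) / (8 * T))) z := by
    intro z _
    have h := (((((hasDerivAt_pow 2 z).sub_const (s ^ 2)).neg).div_const (8 * T)).exp).const_mul
      (-2 : ℝ)
    refine HasDerivAt.congr_deriv (by simpa using! h) ?_
    field_simp
    norm_num
    ring_nf
  have hp : ∀ z ∈ Ioi s, 0 ≤ z / (2 * T) * Real.exp (-(z ^ 2 - s ^ 2) / (8 * T)) := fun z hz => by
    have : 0 < z := hs.trans hz
    positivity
  have hl : Tendsto (fun z => -2 * Real.exp (-(z ^ 2 - s ^ 2) / (8 * T))) atTop (nhds (-2 * 0)) := by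
    refine Tendsto.const_mul _ (Real.tendsto_exp_atBot.comp ?_)
    refine Tendsto.atBot_div_const (by positivity) (tendsto_neg_atTop_atBot.comp ?_)
    exact tendsto_atTop_add_const_right _ _ (tendsto_pow_atTop two_ne_zero)
  have hi := integral_Ioi_of_hasDerivAt_of_nonneg' hd hp hl
  have hint := integrableOn_Ioi_deriv_of_nonneg' hd hp hl
  calc ∫⁻ z, hardyKernel T z s
      ≤ ∫⁻ z in Ioi s, ENNReal.ofReal (z / (2 * T) * Real.exp (-(z ^ 2 - s ^ 2) / (8 * T))) := by
        rw [← lintegral_indicator measurableSet_Ioi]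
        gcongr with z
        unfold hardyKernel
        split_ifs with h
        · rw [indicator_of_mem (show z ∈ Ioi s from h.2)]
        · exact zero_le
    _ = ENNReal.ofReal 2 := by
        rw [← ofReal_integral_eq_lintegral_ofReal hint
          ((ae_restrict_iff' measurableSet_Ioi).2 (Eventually.of_forall hp)), hi]
        simp
    _ ≤ 2 := by simp

lemma lintegral_hardyKernel_snd_le {T : ℝ} (hT : 0 < T) (z : ℝ) :
    ∫⁻ s, hardyKernel T z s ≤ 4 := by
  rcases le_or_gt z 0 with hz | hz
  · have : ∀ s, ¬ (0 < s ∧ s < z) := fun s h => by linarith [h.1, h.2]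
    simp [hardyKernel, this]
  have hd : ∀ s ∈ uIcc 0 z, HasDerivAt (fun s => 4 * Real.exp (-(z * (z - s)) / (8 * T)))
      (z / (2 * T) * Real.exp (-(z * (z - s)) / (8 * T))) s := by
    intro s _
    have h := ((((((hasDerivAt_id s).const_sub z).const_mul z).neg).div_const (8 * T)).exp).const_mul
      (4 : ℝ)
    refine HasDerivAt.congr_deriv (by simpa using! h) ?_
    field_simp
    norm_num
  have hc : Continuous fun s => z / (2 * T) * Real.exp (-(z * (z - s)) / (8 * T)) := by fun_prop
  have hi := intervalIntegral.integral_eq_sub_of_hasDerivAt hd (hc.intervalIntegrable _ _)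
  calc ∫⁻ s, hardyKernel T z s
      ≤ ∫⁻ s in Ioc 0 z, ENNReal.ofReal (z / (2 * T) * Real.exp (-(z * (z - s)) / (8 * T))) := by
        rw [← lintegral_indicator measurableSet_Ioc]
        gcongr with s
        unfold hardyKernel
        split_ifs with h
        · rw [indicator_of_mem (show s ∈ Ioc 0 z from ⟨h.1, h.2.le⟩)]
          gcongr ENNReal.ofReal (_ * Real.exp (?_ / _))
          nlinarith [h.1, h.2]
        · exact zero_le
    _ = ENNReal.ofReal (4 - 4 * Real.exp (-(z * z) / (8 * T))) := by
        rw [← ofReal_integral_eq_lintegral_ofReal (hc.intervalIntegrable _ _).1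
          (Eventually.of_forall fun s => by positivity), ← intervalIntegral.integral_of_le hz.le, hi]
        simp
    _ ≤ ENNReal.ofReal 4 := ENNReal.ofReal_le_ofReal (by
        have := Real.exp_pos (-(z * z) / (8 * T)); linarith)
    _ = 4 := by simp

lemma lintegral_sq_hardyKernel_snd_le {T : ℝ} (hT : 0 < T) (z : ℝ) :
    ∫⁻ s, hardyKernel T z s ^ 2 ≤ ENNReal.ofReal (z / (2 * T)) * 4 := by
  refine le_trans ?_ (mul_le_mul_right (lintegral_hardyKernel_snd_le hT z) _)
  rw [← lintegral_const_mul' _ _ (by simp)]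
  gcongr with s
  rw [pow_two]
  gcongr
  unfold hardyKernel
  split_ifs with h
  · refine ENNReal.ofReal_le_ofReal (mul_le_of_le_one_right ?_ (Real.exp_le_one_iff.2 ?_))
    · have : 0 < z := h.1.trans h.2
      positivity
    · refine div_nonpos_of_nonpos_of_nonneg ?_ (by positivity)
      nlinarith [h.1, h.2]
  · exact zero_le

lemma lintegral_sq_hardyKernel_mul_le {T : ℝ} (hT : 0 < T) {h : ℝ → ENNReal} (hh : Measurable h) :
    ∫⁻ z in Ioi 0, (∫⁻ s in Ioi 0, hardyKernel T z s * h s) ^ 2 ≤ 8 * ∫⁻ s in Ioi 0, h s ^ 2 := by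
  refine (lintegral_sq_kernel_le _ _ (measurable_hardyKernel T) hh (A := 4) (B := 2)
    (Eventually.of_forall fun z => ?_) (Eventually.of_forall fun s => ?_)).trans (by norm_num)
  · exact (setLIntegral_le_lintegral _ _).trans (lintegral_hardyKernel_snd_le hT z)
  · exact (setLIntegral_le_lintegral _ _).trans (lintegral_hardyKernel_fst_le hT s)

lemma lintegral_sq_hardyKernel_adjoint_mul_le {T : ℝ} (hT : 0 < T) {h : ℝ → ENNReal}
    (hh : Measurable h) :
    ∫⁻ z in Ioi 0, (∫⁻ s in Ioi 0, hardyKernel T s z * h s) ^ 2 ≤ 8 * ∫⁻ s in Ioi 0, h s ^ 2 := by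
  refine (lintegral_sq_kernel_le _ _ (k := fun z s => hardyKernel T s z)
    ((measurable_hardyKernel T).comp measurable_swap) hh (A := 2) (B := 4)
    (Eventually.of_forall fun z => ?_) (Eventually.of_forall fun s => ?_)).trans (by norm_num)
  · exact (setLIntegral_le_lintegral _ _).trans (lintegral_hardyKernel_fst_le hT z)
  · exact (setLIntegral_le_lintegral _ _).trans (lintegral_hardyKernel_snd_le hT s)

lemma angT_pos {t : ℝ} (ht : 0 ≤ t) : 0 < angT t := by unfold angT; linarith

lemma one_le_thw {t : ℝ} (ht : 0 ≤ t) (z : ℝ) : 1 ≤ thw t 1 z := by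
  have := angT_pos ht
  exact Real.one_le_exp (by positivity)

lemma enorm_thw_mul_phiF_le {t : ℝ} (ht : 0 ≤ t) (g : ℝ → ℝ → ℝ → ℝ) (x y : ℝ) {z : ℝ}
    (hz : 0 < z) :
    ‖thw t 1 z * (z / (2 * angT t) * phiF t g x y z)‖ₑ ≤
      ∫⁻ s in Ioi 0, hardyKernel (angT t) z s * ‖thw t 1 s * g x y s‖ₑ := by
  have hT := angT_pos ht
  rw [phiF, intervalIntegral.integral_of_le hz.le, ← mul_assoc, ← mul_assoc, enorm_mul]
  refine (mul_le_mul_right (enorm_integral_le_lintegral_enorm _) _).trans ?_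
  rw [← lintegral_const_mul' _ _ enorm_ne_top, ← restrict_Ioo_eq_restrict_Ioc]
  refine (setLIntegral_mono_ae' measurableSet_Ioo (g := fun s =>
    hardyKernel (angT t) z s * ‖thw t 1 s * g x y s‖ₑ) (Eventually.of_forall fun s hs => ?_)).trans
    (lintegral_mono_set fun s hs => hs.1)
  have hk : hardyKernel (angT t) z s =
      ‖z / (2 * angT t) * Real.exp (-(z ^ 2 - s ^ 2) / (8 * angT t))‖ₑ := by
    rw [hardyKernel, if_pos (show 0 < s ∧ s < z from hs), Real.enorm_eq_ofReal (by positivity)]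
  rw [hk, ← enorm_mul, ← enorm_mul]
  refine le_of_eq (congrArg _ ?_)
  have he : thw t 1 z * Real.exp (-(z ^ 2) / (4 * angT t)) * Real.exp (s ^ 2 / (4 * angT t)) =
      Real.exp (-(z ^ 2 - s ^ 2) / (8 * angT t)) * thw t 1 s := by
    rw [thw, thw, ← Real.exp_add, ← Real.exp_add, ← Real.exp_add]
    congr 1
    field_simp
    ring
  linear_combination (z / (2 * angT t) * g x y s) * he

lemma SmoothThree.measurable_z {g : ℝ → ℝ → ℝ → ℝ} (hg : SmoothThree g) (x y : ℝ) :
    Measurable (g x y) :=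
  (hg.continuous.comp (by fun_prop : Continuous fun z : ℝ => (x, y, z))).measurable

lemma measurable_thw (t lam : ℝ) : Measurable (thw t lam) := by
  unfold thw
  exact Continuous.measurable (by fun_prop)

lemma SmoothThree.lintegral_ur_sq_le {g : ℝ → ℝ → ℝ → ℝ} (hg : SmoothThree g) {t : ℝ}
    (ht : 0 ≤ t) (x y : ℝ) :
    ∫⁻ z in Ioi 0, ‖thw t 1 z * ur t g x y z‖ₑ ^ 2 ≤
      18 * ∫⁻ z in Ioi 0, ‖thw t 1 z * g x y z‖ₑ ^ 2 := by
  have hm : Measurable fun z => ‖thw t 1 z * g x y z‖ₑ :=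
    ((measurable_thw t 1).mul (hg.measurable_z x y)).enorm
  have hK := lintegral_sq_hardyKernel_mul_le (angT_pos ht) hm
  calc ∫⁻ z in Ioi 0, ‖thw t 1 z * ur t g x y z‖ₑ ^ 2
      ≤ ∫⁻ z in Ioi 0, (2 * ‖thw t 1 z * g x y z‖ₑ ^ 2 + 2 * (∫⁻ s in Ioi 0,
          hardyKernel (angT t) z s * ‖thw t 1 s * g x y s‖ₑ) ^ 2) := by
        refine setLIntegral_mono_ae' measurableSet_Ioi (Eventually.of_forall fun z hz => ?_)
        rw [hg.ur_eq, mul_sub]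
        refine (enorm_sub_sq_le _ _).trans ?_
        gcongr
        exact enorm_thw_mul_phiF_le ht g x y hz
    _ = 2 * (∫⁻ z in Ioi 0, ‖thw t 1 z * g x y z‖ₑ ^ 2) + 2 * ∫⁻ z in Ioi 0, (∫⁻ s in Ioi 0,
          hardyKernel (angT t) z s * ‖thw t 1 s * g x y s‖ₑ) ^ 2 := by
        rw [lintegral_add_left ((hm.pow_const 2).const_mul 2), lintegral_const_mul' _ _ (by simp),
          lintegral_const_mul' _ _ (by simp)]
    _ ≤ 2 * (∫⁻ z in Ioi 0, ‖thw t 1 z * g x y z‖ₑ ^ 2) +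
          2 * (8 * ∫⁻ z in Ioi 0, ‖thw t 1 z * g x y z‖ₑ ^ 2) := by gcongr
    _ = _ := by ring

lemma SmoothThree.enorm_ur_sq_le {g : ℝ → ℝ → ℝ → ℝ} (hg : SmoothThree g) {t : ℝ}
    (ht : 0 ≤ t) (x y : ℝ) {z : ℝ} (hz : 0 < z) :
    ‖ur t g x y z‖ₑ ^ 2 ≤ 8 * ((∫⁻ z in Ioi 0, ‖thw t 1 z * g x y z‖ₑ ^ 2) +
      ∫⁻ z in Ioi 0, ‖thw t 1 z * _root_.pdz g x y z‖ₑ ^ 2) := by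
  have hT := angT_pos ht
  have hm : Measurable fun z => ‖thw t 1 z * g x y z‖ₑ :=
    ((measurable_thw t 1).mul (hg.measurable_z x y)).enorm
  have hθ : ∀ z c : ℝ, ‖c‖ₑ ≤ ‖thw t 1 z * c‖ₑ := fun z c => by
    rw [enorm_mul]
    refine le_mul_of_one_le_left' ?_
    rw [Real.enorm_eq_ofReal (zero_le_one.trans (one_le_thw ht z))]
    simpa using one_le_thw ht z
  set A := ∫⁻ z in Ioi 0, ‖thw t 1 z * g x y z‖ₑ ^ 2 with hA
  set B := ∫⁻ z in Ioi 0, ‖thw t 1 z * _root_.pdz g x y z‖ₑ ^ 2 with hB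
  have h1 : ‖g x y z‖ₑ ^ 2 ≤ 2 * (A + B) := by
    refine (enorm_sq_le_lintegral_Ioc (hg.hasDerivAt_z x y) (hg.pdz.continuous.comp
      (by fun_prop : Continuous fun z : ℝ => (x, y, z))) z).trans ?_
    rw [hA, hB, ← lintegral_add_left (hm.pow_const 2)]
    refine mul_le_mul_right ((lintegral_mono_set (t := Ioi 0)
      fun s (hs : s ∈ Ioc z (z + 1)) => hz.trans hs.1).trans ?_) _
    gcongr <;> exact hθ _ _
  have h2 : ‖z / (2 * angT t) * phiF t g x y z‖ₑ ^ 2 ≤ 2 * A := by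
    have h3 : ‖thw t 1 z‖ₑ ^ 2 * ‖z / (2 * angT t) * phiF t g x y z‖ₑ ^ 2 ≤
        ENNReal.ofReal (z / (2 * angT t)) * 4 * A := by
      rw [← mul_pow, ← enorm_mul]
      calc _ ≤ (∫⁻ s in Ioi 0, hardyKernel (angT t) z s * ‖thw t 1 s * g x y s‖ₑ) ^ 2 := by
            gcongr; exact enorm_thw_mul_phiF_le ht g x y hz
        _ ≤ (∫⁻ s in Ioi 0, hardyKernel (angT t) z s ^ 2) * A :=
            sq_lintegral_mul_le _ ((measurable_hardyKernel _).comp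
              measurable_prodMk_left).aemeasurable hm.aemeasurable
        _ ≤ _ := by
            gcongr
            exact (setLIntegral_le_lintegral _ _).trans (lintegral_sq_hardyKernel_snd_le hT z)
    have h4 : ENNReal.ofReal (z / (2 * angT t)) * 4 ≤ ‖thw t 1 z‖ₑ ^ 2 * 2 := by
      rw [Real.enorm_sq_eq_ofReal, show (4 : ENNReal) = ENNReal.ofReal 4 by simp,
        show (2 : ENNReal) = ENNReal.ofReal 2 by simp, ← ENNReal.ofReal_mul (by positivity),
        ← ENNReal.ofReal_mul (by positivity)]
      refine ENNReal.ofReal_le_ofReal ?_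
      have h5 : thw t 1 z ^ 2 = Real.exp (z ^ 2 / (4 * angT t)) := by
        rw [thw, ← Real.exp_nat_mul]
        congr 1
        push_cast
        field_simp
        norm_num
      have h6 := Real.add_one_le_exp (z ^ 2 / (4 * angT t))
      have h7 : 1 ≤ angT t := by unfold angT; linarith
      have h8 : z / (2 * angT t) * 4 ≤ (z ^ 2 / (4 * angT t) + 1) * 2 := by
        have : (z ^ 2 / (4 * angT t) + 1) * 2 - z / (2 * angT t) * 4 =
          ((z - 2) ^ 2 + 4 * (angT t - 1)) / (2 * angT t) := by field_simp; ring
        have : 0 ≤ ((z - 2) ^ 2 + 4 * (angT t - 1)) / (2 * angT t) :=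
          div_nonneg (by nlinarith [sq_nonneg (z - 2)]) (by positivity)
        linarith
      rw [h5]
      linarith
    have h9 : ‖thw t 1 z‖ₑ ^ 2 * ‖z / (2 * angT t) * phiF t g x y z‖ₑ ^ 2 ≤
        ‖thw t 1 z‖ₑ ^ 2 * (2 * A) := by
      refine h3.trans ?_
      rw [← mul_assoc]
      gcongr
    have h0 : ‖thw t 1 z‖ₑ ^ 2 ≠ 0 := by
      simp [thw, Real.exp_ne_zero]
    exact (ENNReal.mul_le_mul_iff_right h0 (by simp)).1 h9
  rw [hg.ur_eq]
  calc _ ≤ 2 * ‖g x y z‖ₑ ^ 2 + 2 * ‖z / (2 * angT t) * phiF t g x y z‖ₑ ^ 2 := enorm_sub_sq_le _ _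
    _ ≤ 2 * (2 * (A + B)) + 2 * (2 * A) := by gcongr
    _ = 8 * A + 4 * B := by ring
    _ ≤ 8 * A + 8 * B := by gcongr; norm_num
    _ = _ := by ring

/-- Lebesgue measure on `ℝ² × (0, ∞)` -/
abbrev halfSpace : Measure (ℝ × ℝ × ℝ) :=
  (volume : Measure ℝ).prod ((volume : Measure ℝ).prod (volume.restrict (Ioi (0 : ℝ))))

lemma halfSpace_eq_restrict :
    halfSpace = (volume : Measure (ℝ × ℝ × ℝ)).restrict {p : ℝ × ℝ × ℝ | 0 < p.2.2} := by
  have h1 := Measure.prod_restrict (μ := (volume : Measure ℝ)) (ν := (volume : Measure ℝ))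
    univ (Ioi 0)
  have h2 := Measure.prod_restrict (μ := (volume : Measure ℝ)) (ν := (volume : Measure (ℝ × ℝ)))
    univ (univ ×ˢ Ioi 0)
  rw [Measure.restrict_univ] at h1 h2
  have h3 : {p : ℝ × ℝ × ℝ | 0 < p.2.2} = univ ×ˢ (univ ×ˢ Ioi 0) := by ext p; simp
  rw [halfSpace, h1, h3]
  exact h2

lemma lintegral_halfSpace {F : ℝ × ℝ × ℝ → ENNReal} (hF : Measurable F) :
    ∫⁻ p, F p ∂halfSpace = ∫⁻ x, ∫⁻ y, ∫⁻ z in Ioi (0 : ℝ), F (x, y, z) := by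
  rw [lintegral_prod _ hF.aemeasurable]
  refine lintegral_congr fun x => ?_
  exact lintegral_prod (fun q => F (x, q)) (hF.comp measurable_prodMk_left).aemeasurable

lemma lintegral_halfSpace_swap {F : ℝ × ℝ × ℝ → ENNReal} (hF : Measurable F) :
    ∫⁻ z in Ioi (0 : ℝ), ∫⁻ x, ∫⁻ y, F (x, y, z) = ∫⁻ p, F p ∂halfSpace := by
  rw [lintegral_halfSpace hF, lintegral_lintegral_swap]
  · refine lintegral_congr fun x => ?_
    rw [lintegral_lintegral_swap]
    exact (hF.comp (by fun_prop : Measurable fun q : ℝ × ℝ => (x, q.2, q.1))).aemeasurable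
  · refine Measurable.aemeasurable (Measurable.lintegral_prod_right'
      (f := fun q : (ℝ × ℝ) × ℝ => F (q.1.2, q.2, q.1.1)) ?_)
    exact hF.comp (by fun_prop : Measurable fun q : (ℝ × ℝ) × ℝ => (q.1.2, q.2, q.1.1))

/-- the square of the weighted norm `‖θ ⟨r⟩ⁿ f‖_{L²}` as an extended real -/
def energy (t : ℝ) (n : ℕ) (f : ℝ → ℝ → ℝ → ℝ) : ENNReal :=
  ∫⁻ p, ‖thw t 1 p.2.2 * angR p.1 p.2.1 ^ n * f p.1 p.2.1 p.2.2‖ₑ ^ 2 ∂halfSpace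

@[fun_prop]
lemma continuous_thw (t lam : ℝ) : Continuous (thw t lam) := by
  unfold thw; fun_prop

@[fun_prop]
lemma continuous_angR : Continuous (fun p : ℝ × ℝ × ℝ => angR p.1 p.2.1) := by
  unfold angR; fun_prop

lemma one_le_angR (x y : ℝ) : 1 ≤ angR x y := by
  unfold angR
  rw [Real.one_le_sqrt]
  nlinarith [sq_nonneg x, sq_nonneg y]

lemma angR_le_angR {x₀ y₀ x y : ℝ} (hx : |x₀| ≤ |x|) (hy : |y₀| ≤ |y|) :
    angR x₀ y₀ ≤ angR x y :=
  Real.sqrt_le_sqrt (by linarith [sq_le_sq.2 hx, sq_le_sq.2 hy])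

lemma measurable_energy_integrand (t : ℝ) (n : ℕ) {f : ℝ → ℝ → ℝ → ℝ}
    (hf : Continuous fun p : ℝ × ℝ × ℝ => f p.1 p.2.1 p.2.2) :
    Measurable fun p : ℝ × ℝ × ℝ =>
      ‖thw t 1 p.2.2 * angR p.1 p.2.1 ^ n * f p.1 p.2.1 p.2.2‖ₑ ^ 2 :=
  (Continuous.enorm (by fun_prop)).measurable.pow_const 2

/-- control of the `L^∞_h L²_z` norm -/
def energyLow (t : ℝ) (k : ℕ) (f : ℝ → ℝ → ℝ → ℝ) : ENNReal :=
  (energy t k f + energy t (k + 1) (pdy f)) +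
    (energy t (k + 1) (pdx f) + energy t (k + 2) (pdy (pdx f)))

/-- control of the `L²_h L^∞_z` norm -/
def energyHigh (t : ℝ) (m : ℕ) (f : ℝ → ℝ → ℝ → ℝ) : ENNReal :=
  energy t m f + energy t m (pdz f)

lemma SmoothThree.lintegral_z_le_energyLow {f : ℝ → ℝ → ℝ → ℝ} (hf : SmoothThree f) (t : ℝ)
    (k : ℕ) (x₀ y₀ : ℝ) :
    ∫⁻ z in Ioi (0 : ℝ), ‖thw t 1 z * angR x₀ y₀ ^ k * f x₀ y₀ z‖ₑ ^ 2 ≤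
      4 * energyLow t k f := by
  set E : ℕ → (ℝ → ℝ → ℝ → ℝ) → ℝ × ℝ × ℝ → ENNReal := fun n f p =>
    ‖thw t 1 p.2.2 * angR p.1 p.2.1 ^ n * f p.1 p.2.1 p.2.2‖ₑ ^ 2 with hE
  have hEm : ∀ (n : ℕ) {f : ℝ → ℝ → ℝ → ℝ}, SmoothThree f → Measurable (E n f) :=
    fun n f hf => measurable_energy_integrand t n hf.continuous
  have hEle : ∀ (j : ℕ) (f : ℝ → ℝ → ℝ → ℝ) (z x y : ℝ), |x₀| ≤ |x| → |y₀| ≤ |y| →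
      ‖thw t 1 z * angR x₀ y₀ ^ k‖ₑ ^ 2 * ‖f x y z‖ₑ ^ 2 ≤ E (k + j) f (x, y, z) := by
    intro j f z x y hx hy
    rw [← mul_pow, ← enorm_mul, hE]
    refine pow_le_pow_left' ?_ 2
    change _ ≤ ‖thw t 1 z * angR x y ^ (k + j) * f x y z‖ₑ
    rw [Real.enorm_eq_ofReal_abs, Real.enorm_eq_ofReal_abs, abs_mul, abs_mul _ (f x y z)]
    refine ENNReal.ofReal_le_ofReal (mul_le_mul_of_nonneg_right ?_ (abs_nonneg _))
    have h0 : 0 ≤ angR x₀ y₀ := zero_le_one.trans (one_le_angR _ _)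
    have h1 : 0 ≤ thw t 1 z := (Real.exp_pos _).le
    have h2 : 0 ≤ angR x y := zero_le_one.trans (one_le_angR _ _)
    rw [abs_of_nonneg (by positivity), abs_of_nonneg (by positivity)]
    refine mul_le_mul_of_nonneg_left ?_ h1
    exact (pow_le_pow_left₀ h0 (angR_le_angR hx hy) k).trans
      (pow_le_pow_right₀ (one_le_angR _ _) (Nat.le_add_right k j))
  have hm1 : Measurable fun p => E k f p + E (k + 1) (_root_.pdy f) p :=
    (hEm _ hf).add (hEm _ hf.pdy)
  have hm : Measurable fun p => (E k f p + E (k + 1) (_root_.pdy f) p) +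
      (E (k + 1) (_root_.pdx f) p + E (k + 2) (_root_.pdy (_root_.pdx f)) p) :=
    hm1.add ((hEm _ hf.pdx).add (hEm _ hf.pdx.pdy))
  have hS : ∀ c : ℝ, MeasurableSet {x : ℝ | |c| ≤ |x|} := fun c =>
    measurableSet_le (by fun_prop) (by fun_prop)
  have key : ∀ z, ‖thw t 1 z * angR x₀ y₀ ^ k * f x₀ y₀ z‖ₑ ^ 2 ≤ ∫⁻ x, ∫⁻ y,
      4 * ((E k f (x, y, z) + E (k + 1) (_root_.pdy f) (x, y, z)) +
      (E (k + 1) (_root_.pdx f) (x, y, z) + E (k + 2) (_root_.pdy (_root_.pdx f)) (x, y, z))) := by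
    intro z
    have hz : Continuous fun p : ℝ × ℝ => (p.1, p.2, z) := by fun_prop
    have h1 := enorm_sq_le_lintegral_outward₂ (fun x y => hf.hasDerivAt_x x y z)
      (fun x y => hf.hasDerivAt_y x y z) (fun x y => hf.pdx.hasDerivAt_y x y z)
      (hf.pdx.continuous.comp hz) (hf.pdy.continuous.comp hz) (hf.pdx.pdy.continuous.comp hz) x₀ y₀
    rw [enorm_mul, mul_pow]
    refine (mul_le_mul_right h1 _).trans ?_
    have hfin : ‖thw t 1 z * angR x₀ y₀ ^ k‖ₑ ^ 2 * 4 ≠ ⊤ :=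
      ENNReal.mul_ne_top (ENNReal.pow_ne_top enorm_ne_top) (by simp)
    rw [← mul_assoc, ← lintegral_const_mul' _ _ hfin]
    refine (setLIntegral_mono_ae' (hS x₀) (Eventually.of_forall fun x hx => ?_)).trans
      (setLIntegral_le_lintegral _ _)
    rw [← lintegral_const_mul' _ _ hfin]
    refine (setLIntegral_mono_ae' (hS y₀) (Eventually.of_forall fun y hy => ?_)).trans
      (setLIntegral_le_lintegral _ _)
    have h2 := mul_le_mul_right (add_le_add
      (add_le_add (hEle 0 f z x y hx hy) (hEle 1 (_root_.pdy f) z x y hx hy))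
      (add_le_add (hEle 1 (_root_.pdx f) z x y hx hy)
        (hEle 2 (_root_.pdy (_root_.pdx f)) z x y hx hy))) (4 : ENNReal)
    simp only [← mul_add] at h2
    rw [mul_comm _ (4 : ENNReal), mul_assoc]
    exact h2
  refine (lintegral_mono key).trans (le_of_eq ?_)
  rw [lintegral_halfSpace_swap (F := fun p => 4 * ((E k f p + E (k + 1) (_root_.pdy f) p) +
      (E (k + 1) (_root_.pdx f) p + E (k + 2) (_root_.pdy (_root_.pdx f)) p))) (hm.const_mul 4),
    lintegral_const_mul _ hm,
    lintegral_add_left hm1, lintegral_add_left (hEm _ hf),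
    lintegral_add_left (hEm _ hf.pdx)]
  rfl

/-- product estimate: `L^∞_h L²_z` on the first factor, `L²_h L^∞_z` on the second -/
lemma energy_ur_mul_ur_le {f h : ℝ → ℝ → ℝ → ℝ} (hf : SmoothThree f) (hh : SmoothThree h) {t : ℝ}
    (ht : 0 ≤ t) (k m : ℕ) :
    energy t (k + m) (fun x y z => ur t f x y z * ur t h x y z) ≤
      576 * energyLow t k f * energyHigh t m h := by
  set H : ℝ × ℝ × ℝ → ENNReal := fun p =>
    ‖thw t 1 p.2.2 * angR p.1 p.2.1 ^ m * h p.1 p.2.1 p.2.2‖ₑ ^ 2 +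
      ‖thw t 1 p.2.2 * angR p.1 p.2.1 ^ m * pdz h p.1 p.2.1 p.2.2‖ₑ ^ 2 with hH
  have hHm : Measurable H := (measurable_energy_integrand t m hh.continuous).add
    (measurable_energy_integrand t m hh.pdz.continuous)
  have hHe : ∫⁻ p, H p ∂halfSpace = energyHigh t m h :=
    lintegral_add_left (measurable_energy_integrand t m hh.continuous) _
  have hm : Measurable fun p : ℝ × ℝ × ℝ => ‖thw t 1 p.2.2 * angR p.1 p.2.1 ^ (k + m) *
      (ur t f p.1 p.2.1 p.2.2 * ur t h p.1 p.2.1 p.2.2)‖ₑ ^ 2 :=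
    measurable_energy_integrand t _ (f := fun x y z => ur t f x y z * ur t h x y z)
      ((hf.continuous_ur t).mul (hh.continuous_ur t))
  rw [energy, lintegral_halfSpace hm, ← hHe, ← lintegral_const_mul _ hHm,
    lintegral_halfSpace (hHm.const_mul _)]
  refine lintegral_mono fun x => lintegral_mono fun y => ?_
  change ∫⁻ z in Ioi 0, ‖thw t 1 z * angR x y ^ (k + m) * (ur t f x y z * ur t h x y z)‖ₑ ^ 2 ≤ _
  have hHz : ∫⁻ z in Ioi 0, H (x, y, z) = ‖angR x y ^ m‖ₑ ^ 2 *
      ((∫⁻ z in Ioi 0, ‖thw t 1 z * h x y z‖ₑ ^ 2) +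
        ∫⁻ z in Ioi 0, ‖thw t 1 z * pdz h x y z‖ₑ ^ 2) := by
    have hm1 : Measurable fun z => ‖thw t 1 z * h x y z‖ₑ ^ 2 :=
      ((measurable_thw t 1).mul (hh.measurable_z x y)).enorm.pow_const 2
    rw [← lintegral_add_left hm1,
      ← lintegral_const_mul' _ _ (ENNReal.pow_ne_top enorm_ne_top)]
    refine lintegral_congr fun z => ?_
    simp only [hH, enorm_mul, mul_pow]
    ring
  set A := (∫⁻ z in Ioi 0, ‖thw t 1 z * h x y z‖ₑ ^ 2) +
        ∫⁻ z in Ioi 0, ‖thw t 1 z * pdz h x y z‖ₑ ^ 2 with hA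
  have hlow := hf.lintegral_z_le_energyLow t k x y
  have hlow' : ∫⁻ z in Ioi 0, ‖thw t 1 z * angR x y ^ k * f x y z‖ₑ ^ 2 =
      ‖angR x y ^ k‖ₑ ^ 2 * ∫⁻ z in Ioi 0, ‖thw t 1 z * f x y z‖ₑ ^ 2 := by
    rw [← lintegral_const_mul' _ _ (ENNReal.pow_ne_top enorm_ne_top)]
    refine lintegral_congr fun z => ?_
    simp only [enorm_mul, mul_pow]
    ring
  rw [hlow'] at hlow
  have hum : Measurable fun z => ‖thw t 1 z * ur t f x y z‖ₑ ^ 2 :=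
    ((measurable_thw t 1).mul ((hf.continuous_ur t).comp
      (by fun_prop : Continuous fun z : ℝ => (x, y, z))).measurable).enorm.pow_const 2
  calc ∫⁻ z in Ioi 0, ‖thw t 1 z * angR x y ^ (k + m) * (ur t f x y z * ur t h x y z)‖ₑ ^ 2
      ≤ ∫⁻ z in Ioi 0, (‖angR x y ^ k‖ₑ ^ 2 * ‖angR x y ^ m‖ₑ ^ 2 * (8 * A)) *
          ‖thw t 1 z * ur t f x y z‖ₑ ^ 2 := by
        refine setLIntegral_mono_ae' measurableSet_Ioi (Eventually.of_forall fun z hz => ?_)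
        have h1 := hh.enorm_ur_sq_le ht x y hz
        calc _ = (‖angR x y ^ k‖ₑ ^ 2 * ‖angR x y ^ m‖ₑ ^ 2 * ‖ur t h x y z‖ₑ ^ 2) *
              ‖thw t 1 z * ur t f x y z‖ₑ ^ 2 := by
              simp only [pow_add, enorm_mul, mul_pow]; ring
          _ ≤ _ := by gcongr
    _ = (‖angR x y ^ k‖ₑ ^ 2 * ‖angR x y ^ m‖ₑ ^ 2 * (8 * A)) *
          ∫⁻ z in Ioi 0, ‖thw t 1 z * ur t f x y z‖ₑ ^ 2 := lintegral_const_mul _ hum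
    _ ≤ (‖angR x y ^ k‖ₑ ^ 2 * ‖angR x y ^ m‖ₑ ^ 2 * (8 * A)) *
          (18 * ∫⁻ z in Ioi 0, ‖thw t 1 z * f x y z‖ₑ ^ 2) := by
        gcongr; exact hf.lintegral_ur_sq_le ht x y
    _ = 144 * (‖angR x y ^ k‖ₑ ^ 2 * ∫⁻ z in Ioi 0, ‖thw t 1 z * f x y z‖ₑ ^ 2) *
          (‖angR x y ^ m‖ₑ ^ 2 * A) := by ring
    _ ≤ 144 * (4 * energyLow t k f) * (‖angR x y ^ m‖ₑ ^ 2 * A) := by gcongr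
    _ = (576 * energyLow t k f) * ∫⁻ z in Ioi 0, H (x, y, z) := by rw [hHz]; ring
    _ = _ := (lintegral_const_mul _ (hHm.comp (by fun_prop : Measurable fun z => (x, y, z)))).symm

/-- the weighted norm `‖θ ⟨r⟩ⁿ f‖_{L²}` as an extended real -/
def wnorm (t : ℝ) (n : ℕ) (f : ℝ → ℝ → ℝ → ℝ) : ENNReal :=
  eLpNorm (fun p : ℝ × ℝ × ℝ => thw t 1 p.2.2 * angR p.1 p.2.1 ^ n * f p.1 p.2.1 p.2.2) 2 halfSpace

lemma wnorm_sq (t : ℝ) (n : ℕ) (f : ℝ → ℝ → ℝ → ℝ) : wnorm t n f ^ 2 = energy t n f := by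
  rw [wnorm, eLpNorm_eq_lintegral_rpow_enorm_toReal (by simp) (by simp), ← ENNReal.rpow_natCast,
    ← ENNReal.rpow_mul]
  simp [energy]

/-- control of the `L^∞_h L²_z` norm -/
def wnormLow (t : ℝ) (k : ℕ) (f : ℝ → ℝ → ℝ → ℝ) : ENNReal :=
  (wnorm t k f + wnorm t (k + 1) (pdy f)) +
    (wnorm t (k + 1) (pdx f) + wnorm t (k + 2) (pdy (pdx f)))

/-- control of the `L²_h L^∞_z` norm -/
def wnormHigh (t : ℝ) (m : ℕ) (f : ℝ → ℝ → ℝ → ℝ) : ENNReal :=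
  wnorm t m f + wnorm t m (pdz f)

lemma ENNReal.add_sq_le_sq_add (a b : ENNReal) : a ^ 2 + b ^ 2 ≤ (a + b) ^ 2 := by
  rw [show (a + b) ^ 2 = a ^ 2 + b ^ 2 + 2 * a * b by ring]
  exact le_self_add

lemma wnorm_ur_mul_ur_le {f h : ℝ → ℝ → ℝ → ℝ} (hf : SmoothThree f) (hh : SmoothThree h) {t : ℝ}
    (ht : 0 ≤ t) (k m : ℕ) :
    wnorm t (k + m) (fun x y z => ur t f x y z * ur t h x y z) ≤
      24 * (wnormLow t k f * wnormHigh t m h) := by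
  rw [← ENNReal.pow_le_pow_left_iff two_ne_zero, wnorm_sq]
  refine (energy_ur_mul_ur_le hf hh ht k m).trans ?_
  have h1 : energyLow t k f ≤ wnormLow t k f ^ 2 := by
    simp only [energyLow, wnormLow, ← wnorm_sq]
    exact (add_le_add (ENNReal.add_sq_le_sq_add _ _) (ENNReal.add_sq_le_sq_add _ _)).trans
      (ENNReal.add_sq_le_sq_add _ _)
  have h2 : energyHigh t m h ≤ wnormHigh t m h ^ 2 := by
    simp only [energyHigh, wnormHigh, ← wnorm_sq]
    exact ENNReal.add_sq_le_sq_add _ _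
  calc 576 * energyLow t k f * energyHigh t m h
      ≤ 576 * wnormLow t k f ^ 2 * wnormHigh t m h ^ 2 := by gcongr
    _ = _ := by rw [mul_pow, mul_pow]; norm_num; ring

lemma wnorm_ur_mul_ur_le' {f h : ℝ → ℝ → ℝ → ℝ} (hf : SmoothThree f) (hh : SmoothThree h) {t : ℝ}
    (ht : 0 ≤ t) (k m : ℕ) :
    wnorm t (k + m) (fun x y z => ur t f x y z * ur t h x y z) ≤
      24 * (wnormHigh t k f * wnormLow t m h) := by
  have := wnorm_ur_mul_ur_le hh hf ht m k
  simpa only [mul_comm, add_comm] using this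

lemma wnorm_pdh_ur_sq_le {g : ℝ → ℝ → ℝ → ℝ} (hg : SmoothThree g) (t : ℝ) (a b n : ℕ) :
    wnorm t n (pdh a b fun x' y' z' => ur t g x' y' z' ^ 2) ≤
      ∑ p ∈ Finset.HasAntidiagonal.antidiagonal a, ∑ q ∈ Finset.HasAntidiagonal.antidiagonal b,
        (b.choose q.1 : ENNReal) * (a.choose p.1 : ENNReal) *
          wnorm t n (fun x y z =>
            ur t (pdh p.1 q.1 g) x y z * ur t (pdh p.2 q.2 g) x y z) := by
  have hW : ∀ i j i' j' : ℕ, AEStronglyMeasurable (fun p : ℝ × ℝ × ℝ =>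
      thw t 1 p.2.2 * angR p.1 p.2.1 ^ n * (ur t (pdh i j g) p.1 p.2.1 p.2.2 *
        ur t (pdh i' j' g) p.1 p.2.1 p.2.2)) halfSpace := fun i j i' j' => by
    have h1 := (hg.pdh i j).continuous_ur t
    have h2 := (hg.pdh i' j').continuous_ur t
    exact Continuous.aestronglyMeasurable (by fun_prop)
  have heq : (fun p : ℝ × ℝ × ℝ => thw t 1 p.2.2 * angR p.1 p.2.1 ^ n *
      pdh a b (fun x' y' z' => ur t g x' y' z' ^ 2) p.1 p.2.1 p.2.2) =
      ∑ r ∈ Finset.HasAntidiagonal.antidiagonal a ×ˢ Finset.HasAntidiagonal.antidiagonal b,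
        ((b.choose r.2.1 : ℝ) * (a.choose r.1.1 : ℝ)) • fun p : ℝ × ℝ × ℝ =>
          thw t 1 p.2.2 * angR p.1 p.2.1 ^ n * (ur t (pdh r.1.1 r.2.1 g) p.1 p.2.1 p.2.2 *
            ur t (pdh r.1.2 r.2.2 g) p.1 p.2.1 p.2.2) := by
    ext p
    rw [hg.pdh_ur_sq, Finset.sum_comm, Finset.sum_apply, Finset.sum_product,
      Finset.Nat.sum_antidiagonal_eq_sum_range_succ_mk, Finset.mul_sum]
    refine Finset.sum_congr rfl fun i _ => ?_
    rw [Finset.Nat.sum_antidiagonal_eq_sum_range_succ_mk, Finset.mul_sum]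
    refine Finset.sum_congr rfl fun j _ => ?_
    simp only [Pi.smul_apply, smul_eq_mul]
    ring
  rw [wnorm, heq, ← Finset.sum_product']
  refine (eLpNorm_sum_le (fun r _ => (hW _ _ _ _).const_smul _) (by norm_num)).trans
    (Finset.sum_le_sum fun r _ => ?_)
  rw [eLpNorm_const_smul, enorm_mul, Real.enorm_natCast, Real.enorm_natCast]
  exact le_rfl

/-- `τⁿ Mₙ` as an extended real -/
def wt (τ : ℝ) (n : ℕ) : ENNReal := ENNReal.ofReal (τ ^ n * Mfac n)

/-- `τⁿ / n!` as an extended real -/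
def wtLow (τ : ℝ) (n : ℕ) : ENNReal := ENNReal.ofReal (τ ^ n / n.factorial)

lemma Mfac_add_mul_choose_le {k m : ℕ} (hkm : k ≤ m) :
    ((k + m).choose k : ℝ) * Mfac (k + m) ≤ 16 * ((1 / k.factorial) * Mfac m) := by
  have h1 : ((k + m).choose k : ℝ) = (k + m).factorial / (k.factorial * m.factorial) := by
    rw [Nat.cast_add_choose]
  have hk : (0 : ℝ) < k.factorial := by positivity
  have hm : (0 : ℝ) < m.factorial := by positivity
  have hn : (0 : ℝ) < (k + m).factorial := by positivity
  rw [h1, Mfac, Mfac]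
  have h2 : (((k + m : ℕ) : ℝ) + 1) ^ 4 ≤ (2 * ((m : ℝ) + 1)) ^ 4 := by
    have : (k : ℝ) ≤ m := by exact_mod_cast hkm
    push_cast
    gcongr
    linarith
  calc _ = (((k + m : ℕ) : ℝ) + 1) ^ 4 / (k.factorial * m.factorial) := by field_simp
    _ ≤ (2 * ((m : ℝ) + 1)) ^ 4 / (k.factorial * m.factorial) := by gcongr
    _ = _ := by field_simp; ring

lemma wt_add_mul_choose_le {τ : ℝ} (hτ : 0 < τ) {i j i' j' : ℕ} (h : i + j ≤ i' + j') :
    wt τ ((i + j) + (i' + j')) * (((j + j').choose j : ENNReal) * ((i + i').choose i : ENNReal)) ≤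
      16 * (wtLow τ (i + j) * wt τ (i' + j')) := by
  have h1 : (j + j').choose j * (i + i').choose i ≤
      ((i + j) + (i' + j')).choose (i + j) := by
    rw [show (i + j) + (i' + j') = (i + i') + (j + j') by ring,
      Nat.add_choose_eq (i + i') (j + j'), mul_comm]
    exact Finset.single_le_sum (f := fun p : ℕ × ℕ => (i + i').choose p.1 * (j + j').choose p.2)
      (fun _ _ => Nat.zero_le _) (Finset.HasAntidiagonal.mem_antidiagonal.2 (rfl : (i, j).1 + (i, j).2 = i + j))
  set k := i + j
  set m := i' + j'
  have h2 : ((j + j').choose j : ENNReal) * ((i + i').choose i : ENNReal) ≤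
      ENNReal.ofReal ((k + m).choose k : ℝ) := by
    rw [ENNReal.ofReal_natCast]; exact_mod_cast h1
  refine (mul_le_mul_right h2 _).trans ?_
  have hM : ∀ n, 0 ≤ Mfac n := fun n => by unfold Mfac; positivity
  have hMm := hM m
  have hMk := hM (k + m)
  rw [wt, wt, wtLow, ← ENNReal.ofReal_mul (by positivity), ← ENNReal.ofReal_mul (by positivity),
    show (16 : ENNReal) = ENNReal.ofReal 16 by norm_num, ← ENNReal.ofReal_mul (by positivity)]
  refine ENNReal.ofReal_le_ofReal ?_
  calc τ ^ (k + m) * Mfac (k + m) * ((k + m).choose k : ℝ)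
      = τ ^ (k + m) * (((k + m).choose k : ℝ) * Mfac (k + m)) := by ring
    _ ≤ τ ^ (k + m) * (16 * ((1 / k.factorial) * Mfac m)) := by
        exact mul_le_mul_of_nonneg_left (Mfac_add_mul_choose_le h) (by positivity)
    _ = _ := by rw [pow_add]; ring

lemma wtLow_le {τ₀ τ : ℝ} (hτ : 0 < τ) (hτ₀ : τ ≤ τ₀) (k : ℕ) {p : ℕ} (hp : p ≤ 2) :
    wtLow τ k ≤ ENNReal.ofReal (max 1 τ₀ ^ 2 / τ ^ 2) * wt τ (k + p) := by
  rw [wt, wtLow, ← ENNReal.ofReal_mul (by positivity)]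
  refine ENNReal.ofReal_le_ofReal ?_
  have h1 : τ ^ (2 - p) ≤ max 1 τ₀ ^ 2 :=
    (pow_le_pow_left₀ hτ.le (hτ₀.trans (le_max_right 1 τ₀)) _).trans
      (pow_le_pow_right₀ (le_max_left _ _) (Nat.sub_le _ _))
  have h2 : (1 : ℝ) / k.factorial ≤ Mfac (k + p) := by
    rw [Mfac, div_le_div_iff₀ (by positivity) (by positivity)]
    have hk : (k + p).factorial ≤ (k + p + 1) ^ 4 * k.factorial := by
      calc (k + p).factorial ≤ k.factorial * (k + p) ^ p := by
            rw [← Nat.factorial_mul_ascFactorial]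
            exact Nat.mul_le_mul_left _ (Nat.ascFactorial_le_pow_add k p)
        _ ≤ k.factorial * (k + p + 1) ^ 4 := by
            refine Nat.mul_le_mul_left _ ?_
            exact (Nat.pow_le_pow_left (Nat.le_succ _) p).trans
              (Nat.pow_le_pow_right (Nat.succ_pos _) (by omega))
        _ = _ := mul_comm _ _
    rw [one_mul]
    exact_mod_cast hk
  calc τ ^ k / k.factorial = τ ^ (2 - p) / τ ^ 2 * (τ ^ (k + p) * (1 / k.factorial)) := by
        have : τ ^ (2 - p) * τ ^ (k + p) = τ ^ 2 * τ ^ k := by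
          rw [← pow_add, ← pow_add]; congr 1; omega
        field_simp
        rw [this]; ring
    _ ≤ _ := by gcongr

lemma ENNReal.tsum_sum_antidiagonal (Φ : ℕ → ℕ → ENNReal) :
    ∑' n, ∑ p ∈ Finset.HasAntidiagonal.antidiagonal n, Φ p.1 p.2 = ∑' i, ∑' j, Φ i j := by
  rw [← ENNReal.tsum_prod,
    ← (Finset.HasAntidiagonal.sigmaAntidiagonalEquivProd (A := ℕ)).tsum_eq fun p : ℕ × ℕ => Φ p.1 p.2,
    ENNReal.tsum_sigma']
  refine tsum_congr fun n => ?_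
  rw [tsum_fintype, ← Finset.sum_coe_sort]
  rfl

/-- the summand `τ^k / k! · ‖∂^β g‖_{L^∞_h L²_z}` with `k = |β|` -/
def lowTerm (t τ : ℝ) (g : ℝ → ℝ → ℝ → ℝ) (i j : ℕ) : ENNReal :=
  wtLow τ (i + j) * wnormLow t (i + j) (pdh i j g)

/-- the summand `τ^m M_m · ‖∂^β g‖_{L²_h L^∞_z}` with `m = |β|` -/
def highTerm (t τ : ℝ) (g : ℝ → ℝ → ℝ → ℝ) (i j : ℕ) : ENNReal :=
  wt τ (i + j) * wnormHigh t (i + j) (pdh i j g)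

lemma wt_mul_choose_mul_wnorm_le {g : ℝ → ℝ → ℝ → ℝ} (hg : SmoothThree g) {t τ : ℝ} (ht : 0 ≤ t)
    (hτ : 0 < τ) (i j i' j' : ℕ) :
    wt τ ((i + j) + (i' + j')) * (((j + j').choose j : ENNReal) * ((i + i').choose i : ENNReal) *
      wnorm t ((i + j) + (i' + j')) (fun x y z =>
        ur t (pdh i j g) x y z * ur t (pdh i' j' g) x y z)) ≤
      384 * (lowTerm t τ g i j * highTerm t τ g i' j' + highTerm t τ g i j * lowTerm t τ g i' j') := by
  rw [← mul_assoc, mul_add]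
  rcases le_total (i + j) (i' + j') with h | h
  · refine le_trans ?_ le_self_add
    refine (mul_le_mul' (wt_add_mul_choose_le hτ h)
      (wnorm_ur_mul_ur_le (hg.pdh i j) (hg.pdh i' j') ht (i + j) (i' + j'))).trans (le_of_eq ?_)
    rw [lowTerm, highTerm, show (384 : ENNReal) = 16 * 24 by norm_num]
    ring
  · refine le_trans ?_ le_add_self
    have h1 := wt_add_mul_choose_le hτ h
    rw [add_comm (i' + j'), add_comm j' j, add_comm i' i, ← Nat.choose_symm_add,
      ← Nat.choose_symm_add] at h1
    refine (mul_le_mul' h1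
      (wnorm_ur_mul_ur_le' (hg.pdh i j) (hg.pdh i' j') ht (i + j) (i' + j'))).trans (le_of_eq ?_)
    rw [lowTerm, highTerm, show (384 : ENNReal) = 16 * 24 by norm_num]
    ring

lemma tsum_wt_mul_wnorm_pdh_ur_sq_le {g : ℝ → ℝ → ℝ → ℝ} (hg : SmoothThree g) {t τ : ℝ}
    (ht : 0 ≤ t) (hτ : 0 < τ) :
    ∑' a, ∑' b, wt τ (a + b) * wnorm t (a + b) (pdh a b fun x' y' z' => ur t g x' y' z' ^ 2) ≤
      768 * ((∑' i, ∑' j, lowTerm t τ g i j) * ∑' i, ∑' j, highTerm t τ g i j) := by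
  set Φ : ℕ → ℕ → ℕ → ℕ → ENNReal := fun i i' j j' => 384 * (lowTerm t τ g i j *
    highTerm t τ g i' j' + highTerm t τ g i j * lowTerm t τ g i' j') with hΦ
  have h1 : ∀ a b, wt τ (a + b) * wnorm t (a + b) (pdh a b fun x' y' z' => ur t g x' y' z' ^ 2) ≤
      ∑ p ∈ Finset.HasAntidiagonal.antidiagonal a, ∑ q ∈ Finset.HasAntidiagonal.antidiagonal b,
        Φ p.1 p.2 q.1 q.2 := by
    intro a b
    refine (mul_le_mul_right (wnorm_pdh_ur_sq_le hg t a b (a + b)) _).trans ?_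
    rw [Finset.mul_sum]
    refine Finset.sum_le_sum fun p hp => ?_
    rw [Finset.mul_sum]
    refine Finset.sum_le_sum fun q hq => ?_
    rw [Finset.HasAntidiagonal.mem_antidiagonal] at hp hq
    subst hp hq
    have := wt_mul_choose_mul_wnorm_le hg ht hτ p.1 q.1 p.2 q.2
    rwa [show p.1 + q.1 + (p.2 + q.2) = p.1 + p.2 + (q.1 + q.2) by ring] at this
  have hprod : ∀ F G : ℕ → ℕ → ENNReal, ∑' i, ∑' i', ∑' j, ∑' j', F i j * G i' j' =
      (∑' i, ∑' j, F i j) * ∑' i, ∑' j, G i j := by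
    intro F G
    rw [← ENNReal.tsum_mul_right]
    refine tsum_congr fun i => ?_
    rw [← ENNReal.tsum_mul_left]
    refine tsum_congr fun i' => ?_
    rw [← ENNReal.tsum_mul_right]
    exact tsum_congr fun j => ENNReal.tsum_mul_left
  calc _ ≤ ∑' a, ∑' b, ∑ p ∈ Finset.HasAntidiagonal.antidiagonal a,
          ∑ q ∈ Finset.HasAntidiagonal.antidiagonal b, Φ p.1 p.2 q.1 q.2 :=
        ENNReal.tsum_le_tsum fun a => ENNReal.tsum_le_tsum fun b => h1 a b
    _ = ∑' a, ∑ p ∈ Finset.HasAntidiagonal.antidiagonal a,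
          ∑' b, ∑ q ∈ Finset.HasAntidiagonal.antidiagonal b, Φ p.1 p.2 q.1 q.2 :=
        tsum_congr fun a => Summable.tsum_finsetSum fun _ _ => ENNReal.summable
    _ = ∑' i, ∑' i', ∑' j, ∑' j', Φ i i' j j' := by
        simp only [ENNReal.tsum_sum_antidiagonal]
        exact ENNReal.tsum_sum_antidiagonal fun i i' => ∑' j, ∑' j', Φ i i' j j'
    _ = _ := by
        have h2 : ∑' i, ∑' i', ∑' j, ∑' j', Φ i i' j j' = 384 *
            ((∑' i, ∑' i', ∑' j, ∑' j', lowTerm t τ g i j * highTerm t τ g i' j') +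
              ∑' i, ∑' i', ∑' j, ∑' j', highTerm t τ g i j * lowTerm t τ g i' j') := by
          simp only [hΦ, ENNReal.tsum_mul_left, ENNReal.tsum_add]
        rw [h2, hprod, hprod]
        rw [show (768 : ENNReal) = 384 * 2 by norm_num]
        ring

/-- `‖g‖_{X_τ}` as an extended real -/
def Xsum (t τ : ℝ) (g : ℝ → ℝ → ℝ → ℝ) : ENNReal :=
  ∑' a, ∑' b, wt τ (a + b) * wnorm t (a + b) (pdh a b g)

lemma tsum_tsum_shift_le (F : ℕ → ℕ → ENNReal) (k l : ℕ) :
    ∑' i, ∑' j, F (i + k) (j + l) ≤ ∑' i, ∑' j, F i j :=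
  (ENNReal.tsum_le_tsum fun i => ENNReal.tsum_comp_le_tsum_of_injective
    (add_left_injective l) (F (i + k))).trans
    (ENNReal.tsum_comp_le_tsum_of_injective (add_left_injective k) fun i => ∑' j, F i j)

lemma tsum_lowTerm_le {g : ℝ → ℝ → ℝ → ℝ} (hg : SmoothThree g) {t τ₀ τ : ℝ}
    (hτ : 0 < τ) (hτ₀ : τ ≤ τ₀) :
    ∑' i, ∑' j, lowTerm t τ g i j ≤
      4 * (ENNReal.ofReal (max 1 τ₀ ^ 2 / τ ^ 2) * Xsum t τ g) := by
  set K := ENNReal.ofReal (max 1 τ₀ ^ 2 / τ ^ 2) with hK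
  set F : ℕ → ℕ → ENNReal := fun a b => wt τ (a + b) * wnorm t (a + b) (pdh a b g) with hF
  have h1 : ∀ i j k l, k + l ≤ 2 → wtLow τ (i + j) *
      wnorm t (i + j + (k + l)) (pdh (i + k) (j + l) g) ≤ K * F (i + k) (j + l) := by
    intro i j k l hkl
    have h2 := wtLow_le hτ hτ₀ (i + j) hkl
    rw [hF, show (i + j + (k + l)) = i + k + (j + l) by ring] at *
    simp only [← mul_assoc]
    gcongr
  have h2 : ∀ i j, lowTerm t τ g i j ≤ K * ((F (i + 0) (j + 0) + F (i + 0) (j + 1)) +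
      (F (i + 1) (j + 0) + F (i + 1) (j + 1))) := by
    intro i j
    rw [lowTerm, wnormLow, pdx_pdh, hg.pdy_pdh, hg.pdy_pdh]
    simp only [mul_add]
    exact add_le_add (add_le_add (h1 i j 0 0 (by norm_num)) (h1 i j 0 1 (by norm_num)))
      (add_le_add (h1 i j 1 0 (by norm_num)) (h1 i j 1 1 (by norm_num)))
  refine (ENNReal.tsum_le_tsum fun i => ENNReal.tsum_le_tsum fun j => h2 i j).trans ?_
  simp only [ENNReal.tsum_mul_left, ENNReal.tsum_add]
  rw [mul_left_comm]
  refine mul_le_mul_right ?_ _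
  refine (add_le_add (add_le_add (tsum_tsum_shift_le F 0 0) (tsum_tsum_shift_le F 0 1))
    (add_le_add (tsum_tsum_shift_le F 1 0) (tsum_tsum_shift_le F 1 1))).trans (le_of_eq ?_)
  rw [Xsum]
  ring

lemma tsum_highTerm_eq {g : ℝ → ℝ → ℝ → ℝ} (hg : SmoothThree g) (t τ : ℝ) :
    ∑' i, ∑' j, highTerm t τ g i j = Xsum t τ g + Xsum t τ (pdz g) := by
  simp only [highTerm, wnormHigh, hg.pdz_pdh, mul_add, ENNReal.tsum_add, Xsum]

lemma tsum_wt_mul_wnorm_pdh_ur_sq_le' {g : ℝ → ℝ → ℝ → ℝ} (hg : SmoothThree g) {t τ₀ τ : ℝ}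
    (ht : 0 ≤ t) (hτ : 0 < τ) (hτ₀ : τ ≤ τ₀) :
    ∑' a, ∑' b, wt τ (a + b) * wnorm t (a + b) (pdh a b fun x' y' z' => ur t g x' y' z' ^ 2) ≤
      ENNReal.ofReal (3072 * max 1 τ₀ ^ 2 / τ ^ 2) * (Xsum t τ g + Xsum t τ (pdz g)) *
        Xsum t τ g := by
  refine (tsum_wt_mul_wnorm_pdh_ur_sq_le hg ht hτ).trans ?_
  rw [tsum_highTerm_eq hg]
  refine (mul_le_mul_right (mul_le_mul_left (tsum_lowTerm_le hg hτ hτ₀) _) _).trans (le_of_eq ?_)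
  rw [mul_div_assoc, ENNReal.ofReal_mul (by norm_num),
    show ENNReal.ofReal 3072 = 768 * 4 by norm_num]
  ring

lemma enorm_trip_le (F : ℝ → ℝ → ℝ → ℝ) :
    ‖trip F‖ₑ ≤ ∫⁻ x, ∫⁻ y, ∫⁻ z in Ioi (0 : ℝ), ‖F x y z‖ₑ :=
  (enorm_integral_le_lintegral_enorm _).trans (lintegral_mono fun _ =>
    (enorm_integral_le_lintegral_enorm _).trans (lintegral_mono fun _ =>
      enorm_integral_le_lintegral_enorm _))

lemma thw_two (t z : ℝ) : thw t 2 z = thw t 1 z * thw t 1 z := by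
  rw [thw, thw, ← Real.exp_add]
  congr 1
  ring

lemma lintegral_mul_wnorm_le {Φ : ℝ × ℝ × ℝ → ENNReal} (hΦ : Measurable Φ)
    {G : ℝ → ℝ → ℝ → ℝ} (hG : Continuous fun p : ℝ × ℝ × ℝ => G p.1 p.2.1 p.2.2) (t : ℝ) (n : ℕ)
    {A : ENNReal} (hA : ∫⁻ p, Φ p ^ 2 ∂halfSpace ≤ A ^ 2) :
    ∫⁻ x, ∫⁻ y, ∫⁻ z in Ioi (0 : ℝ), Φ (x, y, z) * ‖thw t 1 z * angR x y ^ n * G x y z‖ₑ ≤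
      A * wnorm t n G := by
  have hGm : Measurable fun p : ℝ × ℝ × ℝ =>
      ‖thw t 1 p.2.2 * angR p.1 p.2.1 ^ n * G p.1 p.2.1 p.2.2‖ₑ :=
    (Continuous.enorm (by fun_prop)).measurable
  rw [← ENNReal.pow_le_pow_left_iff two_ne_zero, mul_pow, wnorm_sq]
  have h1 := lintegral_halfSpace (hΦ.mul hGm)
  simp only [Pi.mul_apply] at h1
  rw [← h1]
  exact (sq_lintegral_mul_le _ hΦ.aemeasurable hGm.aemeasurable).trans (mul_le_mul_left hA _)

lemma SmoothThree.enorm_I3_le {g : ℝ → ℝ → ℝ → ℝ} (hg : SmoothThree g) (t : ℝ) (a b : ℕ) :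
    ‖I3 t g a b‖ₑ ≤ wnorm t (a + b) (_root_.pdh a b fun x' y' z' => ur t g x' y' z' ^ 2) *
      wnorm t (a + b) (_root_.pdh a b g) := by
  have hF := hg.continuous_pdh_ur_sq t a b
  have hFm : Measurable fun p : ℝ × ℝ × ℝ => ‖thw t 1 p.2.2 * angR p.1 p.2.1 ^ (a + b) *
      _root_.pdh a b (fun x' y' z' => ur t g x' y' z' ^ 2) p.1 p.2.1 p.2.2‖ₑ :=
    (Continuous.enorm (by fun_prop)).measurable
  refine le_trans ?_ (lintegral_mul_wnorm_le hFm (hg.pdh a b).continuous t (a + b)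
    (wnorm_sq t (a + b) _).ge)
  rw [I3, enorm_neg]
  refine (enorm_trip_le _).trans (le_of_eq ?_)
  refine lintegral_congr fun x => lintegral_congr fun y => lintegral_congr fun z => ?_
  rw [← enorm_mul, thw_two]
  congr 1
  ring

lemma enorm_mul_thw_mul_integral_Ioi_le {t : ℝ} (ht : 0 ≤ t) (F : ℝ → ℝ) {z : ℝ} (hz : 0 < z) :
    ‖1 / (2 * angT t) * (z * thw t 1 z * ∫ s in Ioi z, F s)‖ₑ ≤
      ∫⁻ s in Ioi 0, hardyKernel (angT t) s z * ‖thw t 1 s * F s‖ₑ := by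
  have hT := angT_pos ht
  rw [← mul_assoc, enorm_mul]
  refine (mul_le_mul_right (enorm_integral_le_lintegral_enorm _) _).trans ?_
  rw [← lintegral_const_mul' _ _ enorm_ne_top]
  refine le_trans ?_ (lintegral_mono_set (Ioi_subset_Ioi hz.le))
  refine setLIntegral_mono_ae' measurableSet_Ioi (Eventually.of_forall fun s hs => ?_)
  have hs' : z < s := hs
  rw [hardyKernel, if_pos ⟨hz, hs'⟩, enorm_mul (thw t 1 s), ← mul_assoc (ENNReal.ofReal _)]
  refine mul_le_mul' ?_ le_rfl
  have h1 : (0 : ℝ) < thw t 1 z := Real.exp_pos _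
  have h2 : (0 : ℝ) < thw t 1 s := Real.exp_pos _
  have hs0 : 0 < s := hz.trans hs'
  rw [Real.enorm_eq_ofReal (by positivity), Real.enorm_eq_ofReal h2.le,
    ← ENNReal.ofReal_mul (by positivity)]
  refine ENNReal.ofReal_le_ofReal ?_
  have h3 : Real.exp (-(s ^ 2 - z ^ 2) / (8 * angT t)) * thw t 1 s = thw t 1 z := by
    rw [thw, thw, ← Real.exp_add]
    congr 1
    field_simp
    ring
  rw [mul_assoc, h3, ← mul_assoc]
  refine mul_le_mul_of_nonneg_right ?_ h1.le
  rw [one_div_mul_eq_div]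
  gcongr

/-- the adjoint Hardy operator applied to `|θ ⟨r⟩ⁿ F|` in the vertical variable -/
def hardyAdjoint (t : ℝ) (n : ℕ) (F : ℝ → ℝ → ℝ → ℝ) (p : ℝ × ℝ × ℝ) : ENNReal :=
  ∫⁻ s in Ioi 0, hardyKernel (angT t) s p.2.2 * ‖thw t 1 s * angR p.1 p.2.1 ^ n * F p.1 p.2.1 s‖ₑ

lemma measurable_hardyAdjoint (t : ℝ) (n : ℕ) {F : ℝ → ℝ → ℝ → ℝ}
    (hF : Continuous fun p : ℝ × ℝ × ℝ => F p.1 p.2.1 p.2.2) :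
    Measurable (hardyAdjoint t n F) := by
  have h1 : Measurable fun q : (ℝ × ℝ × ℝ) × ℝ => hardyKernel (angT t) q.2 q.1.2.2 :=
    (measurable_hardyKernel _).comp
      (by fun_prop : Measurable fun q : (ℝ × ℝ × ℝ) × ℝ => (q.2, q.1.2.2))
  have h2 : Continuous fun q : (ℝ × ℝ × ℝ) × ℝ =>
      thw t 1 q.2 * angR q.1.1 q.1.2.1 ^ n * F q.1.1 q.1.2.1 q.2 := by
    have h3 : Continuous fun q : (ℝ × ℝ × ℝ) × ℝ => (q.1.1, q.1.2.1, q.2) := by fun_prop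
    have h4 : Continuous fun q : (ℝ × ℝ × ℝ) × ℝ => F q.1.1 q.1.2.1 q.2 := hF.comp h3
    have h5 : Continuous fun q : (ℝ × ℝ × ℝ) × ℝ => angR q.1.1 q.1.2.1 :=
      continuous_angR.comp continuous_fst
    fun_prop
  exact Measurable.lintegral_prod_right' (h1.mul h2.enorm.measurable)

lemma lintegral_hardyAdjoint_sq_le {t : ℝ} (ht : 0 ≤ t) (n : ℕ) {F : ℝ → ℝ → ℝ → ℝ}
    (hF : Continuous fun p : ℝ × ℝ × ℝ => F p.1 p.2.1 p.2.2) :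
    ∫⁻ p, hardyAdjoint t n F p ^ 2 ∂halfSpace ≤ (3 * wnorm t n F) ^ 2 := by
  rw [mul_pow, wnorm_sq, energy, lintegral_halfSpace ((measurable_hardyAdjoint t n hF).pow_const 2),
    lintegral_halfSpace (measurable_energy_integrand t n hF)]
  refine le_trans ?_ (mul_le_mul_left (show (8 : ENNReal) ≤ 3 ^ 2 by norm_num) _)
  rw [← lintegral_const_mul' _ _ (by simp)]
  refine lintegral_mono fun x => ?_
  rw [← lintegral_const_mul' _ _ (by simp)]
  refine lintegral_mono fun y => ?_
  have h1 : Measurable fun z : ℝ => ‖thw t 1 z * angR x y ^ n * F x y z‖ₑ := by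
    have h2 : Continuous fun z : ℝ => F x y z :=
      hF.comp (by fun_prop : Continuous fun z : ℝ => (x, y, z))
    exact (Continuous.enorm (by fun_prop)).measurable
  exact lintegral_sq_hardyKernel_adjoint_mul_le (angT_pos ht) h1

lemma SmoothThree.enorm_I6_le {g : ℝ → ℝ → ℝ → ℝ} (hg : SmoothThree g) {t : ℝ} (ht : 0 ≤ t)
    (a b : ℕ) :
    ‖I6 t g a b‖ₑ ≤ 3 * wnorm t (a + b) (_root_.pdh a b fun x' y' z' => ur t g x' y' z' ^ 2) *
      wnorm t (a + b) (_root_.pdh a b g) := by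
  have hF := hg.continuous_pdh_ur_sq t a b
  refine le_trans ?_ (lintegral_mul_wnorm_le (measurable_hardyAdjoint t (a + b) hF)
    (hg.pdh a b).continuous t (a + b) (lintegral_hardyAdjoint_sq_le ht (a + b) hF))
  rw [I6, enorm_mul, enorm_neg]
  refine (mul_le_mul_right (enorm_trip_le _) _).trans ?_
  rw [← lintegral_const_mul' _ _ enorm_ne_top]
  refine lintegral_mono fun x => ?_
  rw [← lintegral_const_mul' _ _ enorm_ne_top]
  refine lintegral_mono fun y => ?_
  rw [← lintegral_const_mul' _ _ enorm_ne_top]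
  refine setLIntegral_mono_ae' measurableSet_Ioi (Eventually.of_forall fun z hz => ?_)
  have h1 := mul_le_mul_left (enorm_mul_thw_mul_integral_Ioi_le ht
    (fun s => angR x y ^ (a + b) *
      _root_.pdh a b (fun x' y' z' => ur t g x' y' z' ^ 2) x y s) hz) ‖thw t 1 z * angR x y ^ (a + b) *
      _root_.pdh a b g x y z‖ₑ
  simp only [← mul_assoc] at h1
  refine le_trans (le_of_eq ?_) h1
  rw [integral_const_mul, ← enorm_mul, ← enorm_mul, thw_two]
  congr 1
  ring

lemma wnorm_eq_ofReal_L2w {t : ℝ} {n : ℕ} {f : ℝ → ℝ → ℝ → ℝ}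
    (h : Integrable (fun p : ℝ × ℝ × ℝ => (thw t 1 p.2.2 * angR p.1 p.2.1 ^ n * f p.1 p.2.1 p.2.2) ^ 2)
      (volume.restrict {p : ℝ × ℝ × ℝ | 0 < p.2.2})) :
    wnorm t n f = ENNReal.ofReal (L2w t 1 n f) := by
  rw [← halfSpace_eq_restrict] at h
  have h1 : ∫ x : ℝ, ∫ y : ℝ, ∫ z in Ioi (0 : ℝ), (thw t 1 z * angR x y ^ n * f x y z) ^ 2 =
      ∫ p, (thw t 1 p.2.2 * angR p.1 p.2.1 ^ n * f p.1 p.2.1 p.2.2) ^ 2 ∂halfSpace := by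
    rw [integral_prod _ h]
    refine integral_congr_ae ?_
    filter_upwards [h.prod_right_ae] with x hx
    exact (integral_prod _ hx).symm
  refine (ENNReal.pow_right_strictMono two_ne_zero).injective ?_
  rw [wnorm_sq, energy, L2w, ← ENNReal.ofReal_pow (Real.sqrt_nonneg _),
    Real.sq_sqrt (by positivity), h1,
    ofReal_integral_eq_lintegral_ofReal h (Eventually.of_forall fun p => sq_nonneg _)]
  exact lintegral_congr fun p => Real.enorm_sq_eq_ofReal _

lemma Mfac_nonneg (n : ℕ) : 0 ≤ Mfac n := by unfold Mfac; positivity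

lemma L2w_nonneg (t lam : ℝ) (n : ℕ) (f : ℝ → ℝ → ℝ → ℝ) : 0 ≤ L2w t lam n f := Real.sqrt_nonneg _

lemma Xel_nonneg {τ : ℝ} (hτ : 0 ≤ τ) (t : ℝ) (g : ℝ → ℝ → ℝ → ℝ) (n : ℕ) : 0 ≤ Xel t τ g n :=
  mul_nonneg (mul_nonneg (Finset.sum_nonneg fun _ _ => L2w_nonneg _ _ _ _) (pow_nonneg hτ n))
    (Mfac_nonneg n)

lemma Xsum_eq_ofReal_Xnrm {t τ : ℝ} {g : ℝ → ℝ → ℝ → ℝ} (hτ : 0 ≤ τ) (hg : L2cond t g)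
    (hs : Summable (Xel t τ g)) : Xsum t τ g = ENNReal.ofReal (Xnrm t τ g) := by
  rw [Xnrm, ENNReal.ofReal_tsum_of_nonneg (Xel_nonneg hτ t g) hs, Xsum,
    ← ENNReal.tsum_sum_antidiagonal]
  refine tsum_congr fun n => ?_
  rw [Xel, mul_assoc, Finset.sum_mul, ENNReal.ofReal_sum_of_nonneg fun _ _ =>
      mul_nonneg (L2w_nonneg _ _ _ _) (mul_nonneg (pow_nonneg hτ n) (Mfac_nonneg n)),
    ← Finset.Nat.sum_antidiagonal_eq_sum_range_succ
      (fun a b => ENNReal.ofReal (L2w t 1 n (pdh a b g) * (τ ^ n * Mfac n)))]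
  refine Finset.sum_congr rfl fun p hp => ?_
  rw [Finset.HasAntidiagonal.mem_antidiagonal] at hp
  subst hp
  rw [wnorm_eq_ofReal_L2w (hg p.1 p.2), wt, mul_comm, ENNReal.ofReal_mul (L2w_nonneg _ _ _ _)]

lemma ofReal_sum_Qterm_le {t τ : ℝ} {g : ℝ → ℝ → ℝ → ℝ} (hτ : 0 ≤ τ) (hg : L2cond t g)
    {I : ℕ → ℕ → ℝ} {P : ℕ → ℕ → ENNReal}
    (hI : ∀ a b, ‖I a b‖ₑ ≤ P a b * wnorm t (a + b) (pdh a b g)) (N : ℕ) :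
    ENNReal.ofReal (∑ n ∈ Finset.range N, Qterm t τ g I n) ≤
      ∑' a, ∑' b, wt τ (a + b) * P a b := by
  have hnn : ∀ n a b, 0 ≤ |I a b| * τ ^ n * Mfac n / L2w t 1 n (pdh a b g) := fun n a b =>
    div_nonneg (mul_nonneg (mul_nonneg (abs_nonneg _) (pow_nonneg hτ n)) (Mfac_nonneg n))
      (L2w_nonneg _ _ _ _)
  have hQ : ∀ n, 0 ≤ Qterm t τ g I n := fun n => Finset.sum_nonneg fun a _ => hnn n a (n - a)
  rw [ENNReal.ofReal_sum_of_nonneg fun n _ => hQ n,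
    ← ENNReal.tsum_sum_antidiagonal]
  refine le_trans (Finset.sum_le_sum fun n _ => ?_) (ENNReal.sum_le_tsum _)
  rw [Qterm, ENNReal.ofReal_sum_of_nonneg fun a _ => hnn n a (n - a),
    ← Finset.Nat.sum_antidiagonal_eq_sum_range_succ
      (fun a b => ENNReal.ofReal (|I a b| * τ ^ n * Mfac n / L2w t 1 n (pdh a b g)))]
  refine Finset.sum_le_sum fun p hp => ?_
  rw [Finset.HasAntidiagonal.mem_antidiagonal] at hp
  subst hp
  have h1 := hI p.1 p.2
  rw [wnorm_eq_ofReal_L2w (hg p.1 p.2), Real.enorm_eq_ofReal_abs] at h1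
  rcases (L2w_nonneg t 1 (p.1 + p.2) (pdh p.1 p.2 g)).eq_or_lt with h0 | h0
  · rw [← h0, div_zero, ENNReal.ofReal_zero]
    exact zero_le
  · rw [ENNReal.ofReal_div_of_pos h0]
    refine ENNReal.div_le_of_le_mul ?_
    rw [mul_assoc, ENNReal.ofReal_mul (abs_nonneg _), mul_comm, wt, mul_assoc]
    exact mul_le_mul_right h1 _

/-- estimate of the quadratic terms `I₃` and `I₆`. -/
theorem estimate_I3_I6 (τ₀ : ℝ) (hτ₀ : 0 < τ₀) :
    ∃ C : ℝ, 0 < C ∧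
      ∀ t : ℝ, 0 ≤ t → ∀ g : ℝ → ℝ → ℝ → ℝ, DecaySmooth g → L2cond t g → L2condZ t g →
        ∀ τ : ℝ, 0 < τ → τ ≤ τ₀ →
          Summable (Xel t τ g) → Summable (Del t τ g) →
          ∀ N : ℕ,
            (∑ n ∈ Finset.range N, Qterm t τ g (I3 t g) n) +
              (∑ n ∈ Finset.range N, Qterm t τ g (I6 t g) n) ≤
              C / τ ^ 2 * (Xnrm t τ g + Dnrm t τ g) * Xnrm t τ g := by
  refine ⟨4 * (3072 * max 1 τ₀ ^ 2), by positivity, ?_⟩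
  intro t ht g hgd hL hLZ τ hτ hττ₀ hX hD N
  have hg : SmoothThree g := hgd.1
  have hXn : 0 ≤ Xnrm t τ g := tsum_nonneg (Xel_nonneg hτ.le t g)
  have hDn : 0 ≤ Dnrm t τ g := tsum_nonneg (Xel_nonneg hτ.le t (pdz g))
  set P : ℕ → ℕ → ENNReal := fun a b =>
    wnorm t (a + b) (pdh a b fun x' y' z' => ur t g x' y' z' ^ 2) with hP
  have h3 := ofReal_sum_Qterm_le hτ.le hL (P := P) (hg.enorm_I3_le t) N
  have h6 := ofReal_sum_Qterm_le hτ.le hL (P := fun a b => 3 * P a b) (hg.enorm_I6_le ht) N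
  have hS := tsum_wt_mul_wnorm_pdh_ur_sq_le' hg ht hτ hττ₀
  rw [Xsum_eq_ofReal_Xnrm hτ.le hL hX, Xsum_eq_ofReal_Xnrm (g := pdz g) hτ.le hLZ hD,
    show Xnrm t τ (pdz g) = Dnrm t τ g from rfl,
    ← ENNReal.ofReal_add hXn hDn, ← ENNReal.ofReal_mul (by positivity),
    ← ENNReal.ofReal_mul (by positivity)] at hS
  simp only [mul_left_comm _ (3 : ENNReal), ENNReal.tsum_mul_left] at h6
  rw [← ENNReal.ofReal_le_ofReal_iff (by positivity)]
  refine ENNReal.ofReal_add_le.trans ((add_le_add h3 h6).trans ?_)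
  rw [← one_add_mul, show (1 + 3 : ENNReal) = ENNReal.ofReal 4 by norm_num]
  refine (mul_le_mul_right hS _).trans (le_of_eq ?_)
  rw [← ENNReal.ofReal_mul (by norm_num)]
  congr 1
  ring
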